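/- arXiv:0707.1505 — 6 statements merged into one kernel-verified Lean document; each statement's English description precedes it below -/
import Mathlib

section
/- For every real λ ≥ 1 there is a constant C > 0 (depending on N, F₀,…,F_N, a, and λ) such that for all real s > 0: Σ over good rational primes p of (log p)/(p·exp(s·m_p(φ,P)^λ)) ≤ C·s^{−1/λ}. -/
open MvPolynomial Filter Topology

noncomputable section

/-- The map on integer vectors induced by the homogeneous polynomials `Fp i`. -/
def Fmap {N : ℕ} (Fp : Fin (N + 1) → MvPolynomial (Fin (N + 1)) ℤ) :
    (Fin (N + 1) → ℤ) → (Fin (N + 1) → ℤ) :=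
  fun b i => MvPolynomial.eval b (Fp i)

/-- A rational prime `p` is good if the reductions of the `Fp i` modulo `p` have no common
zero in an algebraic closure of `𝔽_p` other than the origin. -/
def GoodPrime {N : ℕ} (Fp : Fin (N + 1) → MvPolynomial (Fin (N + 1)) ℤ) (p : ℕ) : Prop :=
  ∃ _ : Fact p.Prime,
    ∀ x : Fin (N + 1) → AlgebraicClosure (ZMod p),
      (∀ i, MvPolynomial.aeval x (Fp i) = 0) → x = 0

/-- The number of distinct points of `ℙ^N(𝔽_p)` represented by the reductions mod `p` of the
iterates `F^[n](a)`, i.e. the size of the orbit of `P mod p`. -/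
def orbitLen {N : ℕ} (Fp : Fin (N + 1) → MvPolynomial (Fin (N + 1)) ℤ)
    (a : Fin (N + 1) → ℤ) (p : ℕ) : ℕ :=
  Set.ncard (Set.range fun n : ℕ =>
    Quotient.mk (MulAction.orbitRel (ZMod p)ˣ (Fin (N + 1) → ZMod p))
      (fun i => (((Fmap Fp)^[n] a) i : ZMod p)))

lemma mertens_upper (n : ℕ) (hn : 1 ≤ n) :
    ∑ p ∈ Nat.primesLE n, Real.log p / p ≤ Real.log n + Real.log 4 := by
  have hdvd : ∏ p ∈ Nat.primesLE n, p ^ (n / p) ∣ n.factorial := by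
    apply Finset.prod_dvd_of_isRelPrime
    · intro p hp q hq hpq
      have hp' := Nat.prime_of_mem_primesLE hp
      have hq' := Nat.prime_of_mem_primesLE hq
      exact Nat.coprime_iff_isRelPrime.mp
        (Nat.Coprime.pow _ _ ((Nat.coprime_primes hp' hq').mpr hpq))
    · intro p hp
      have hp' := Nat.prime_of_mem_primesLE hp
      rw [hp'.pow_dvd_factorial_iff (b := Nat.log p n + 2) (by omega)]
      calc n / p = n / p ^ 1 := by rw [pow_one]
        _ ≤ _ := Finset.single_le_sum (f := fun i => n / p ^ i) (fun _ _ => Nat.zero_le _)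
          (by simp)
  have hle : ∏ p ∈ Nat.primesLE n, p ^ (n / p) ≤ n ^ n :=
    (Nat.le_of_dvd (Nat.factorial_pos n) hdvd).trans (Nat.factorial_le_pow n)
  have hpos : 0 < ∏ p ∈ Nat.primesLE n, p ^ (n / p) :=
    Finset.prod_pos fun p hp => pow_pos (Nat.prime_of_mem_primesLE hp).pos _
  have hlog : ∑ p ∈ Nat.primesLE n, ((n / p : ℕ) : ℝ) * Real.log p ≤ n * Real.log n := by
    have h1 : Real.log ((∏ p ∈ Nat.primesLE n, p ^ (n / p) : ℕ) : ℝ) ≤ Real.log ((n ^ n : ℕ) : ℝ) :=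
      Real.log_le_log (by exact_mod_cast hpos) (by exact_mod_cast hle)
    push_cast at h1
    rw [Real.log_pow, Real.log_prod] at h1
    · simpa [Real.log_pow] using h1
    · intro p hp
      have := (Nat.prime_of_mem_primesLE hp).pos
      positivity
  have hth := Chebyshev.theta_le_log4_mul_x (x := (n : ℝ)) (by positivity)
  rw [Chebyshev.theta_eq_sum_primesLE_log] at hth
  have hn' : (0 : ℝ) < n := by exact_mod_cast hn
  have key : (n : ℝ) * ∑ p ∈ Nat.primesLE n, Real.log p / p ≤
      ∑ p ∈ Nat.primesLE n, ((n / p : ℕ) : ℝ) * Real.log p + ∑ p ∈ Nat.primesLE n, Real.log p := by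
    rw [Finset.mul_sum, ← Finset.sum_add_distrib]
    apply Finset.sum_le_sum
    intro p hp
    have hp' := Nat.prime_of_mem_primesLE hp
    have h0 : 0 ≤ Real.log p := Real.log_natCast_nonneg p
    have h1 : (n : ℝ) / p ≤ ((n / p : ℕ) : ℝ) + 1 := by
      rw [div_le_iff₀ (by exact_mod_cast hp'.pos)]
      have := Nat.lt_div_mul_add (a := n) hp'.pos
      have : n ≤ (n / p + 1) * p := by rw [add_mul, one_mul]; omega
      exact_mod_cast this
    calc (n : ℝ) * (Real.log p / p) = (n / p) * Real.log p := by ring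
      _ ≤ _ := by nlinarith
  have : (n : ℝ) * ∑ p ∈ Nat.primesLE n, Real.log p / p ≤ n * (Real.log n + Real.log 4) := by
    linarith
  exact le_of_mul_le_mul_left this hn'

/-- Sum of `log p / p` over a finite set of primes whose product is at most `exp X`. -/
lemma sum_log_div_le (S : Finset ℕ) (hS : ∀ p ∈ S, p.Prime) (X : ℕ) (hX : 1 ≤ X)
    (h : ∑ p ∈ S, Real.log p ≤ X) :
    ∑ p ∈ S, Real.log p / p ≤ Real.log X + Real.log 4 + 1 := by
  rw [← Finset.sum_filter_add_sum_filter_not S (fun p => p ≤ X)]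
  have hX' : (0 : ℝ) < X := by exact_mod_cast hX
  have h1 : ∑ p ∈ S with p ≤ X, Real.log p / p ≤ Real.log X + Real.log 4 := by
    refine le_trans ?_ (mertens_upper X hX)
    apply Finset.sum_le_sum_of_subset_of_nonneg
    · intro p hp
      rw [Finset.mem_filter] at hp
      exact Nat.mem_primesLE.mpr ⟨hp.2, hS p hp.1⟩
    · intro p _ _
      exact div_nonneg (Real.log_natCast_nonneg p) (by positivity)
  have h2 : ∑ p ∈ S with ¬ p ≤ X, Real.log p / p ≤ 1 := by
    calc ∑ p ∈ S with ¬ p ≤ X, Real.log p / p ≤ ∑ p ∈ S with ¬ p ≤ X, Real.log p / X := by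
          apply Finset.sum_le_sum
          intro p hp
          rw [Finset.mem_filter, not_le] at hp
          exact div_le_div_of_nonneg_left (Real.log_natCast_nonneg p) hX'
            (by exact_mod_cast hp.2.le)
      _ ≤ ∑ p ∈ S, Real.log p / X := by
          apply Finset.sum_le_sum_of_subset_of_nonneg (Finset.filter_subset _ _)
          intro p _ _
          exact div_nonneg (Real.log_natCast_nonneg p) (by positivity)
      _ = (∑ p ∈ S, Real.log p) / X := by rw [Finset.sum_div]
      _ ≤ 1 := by rw [div_le_one hX']; exact h
  linarith

/-- Discrete partial summation. -/
lemma abel_bound {ι : Type*} (T : Finset ι) (w : ι → ℝ) (m : ι → ℕ) (C : ℝ)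
    (hA : ∀ k : ℕ, ∑ i ∈ T with m i ≤ k, w i ≤ C * k)
    (g : ℕ → ℝ) (hg : Antitone g) (M : ℕ) :
    ∑ i ∈ T with m i ≤ M, w i * g (m i) + (C * M - ∑ i ∈ T with m i ≤ M, w i) * g M
      ≤ C * ∑ k ∈ Finset.range M, g (k + 1) := by
  classical
  induction M with
  | zero =>
    have h : ∑ i ∈ T with m i ≤ 0, w i * g (m i) = (∑ i ∈ T with m i ≤ 0, w i) * g 0 := by
      rw [Finset.sum_mul]
      apply Finset.sum_congr rfl
      intro i hi
      rw [Finset.mem_filter] at hi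
      rw [Nat.le_zero.mp hi.2]
    rw [h]; simp
  | succ M ih =>
    have split : ∀ f : ι → ℝ, ∑ i ∈ T with m i ≤ M + 1, f i =
        ∑ i ∈ T with m i ≤ M, f i + ∑ i ∈ T with m i = M + 1, f i := by
      intro f
      simp only [Finset.sum_filter]
      rw [← Finset.sum_add_distrib]
      apply Finset.sum_congr rfl
      intro i _
      split_ifs <;> first | omega | simp
    have h : ∑ i ∈ T with m i = M + 1, w i * g (m i) =
        (∑ i ∈ T with m i = M + 1, w i) * g (M + 1) := by
      rw [Finset.sum_mul]
      apply Finset.sum_congr rfl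
      intro i hi
      rw [Finset.mem_filter] at hi
      rw [hi.2]
    rw [split, split, h, Finset.sum_range_succ]
    have h1 := hA M
    have h2 : g (M + 1) ≤ g M := hg (Nat.le_succ M)
    have h3 := mul_le_mul_of_nonneg_left h2 (sub_nonneg.mpr h1)
    push_cast
    nlinarith

lemma sum_exp_le (l s : ℝ) (hl : 1 ≤ l) (hs : 0 < s) (M : ℕ) :
    ∑ k ∈ Finset.range M, Real.exp (-s * ((k + 1 : ℕ) : ℝ) ^ l) ≤
      s ^ (-1 / l) * Real.Gamma (1 / l + 1) := by
  have hl0 : 0 < l := by linarith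
  rw [← integral_exp_neg_mul_rpow hl0 hs]
  have hanti : AntitoneOn (fun x : ℝ => Real.exp (-s * x ^ l)) (Set.Icc 0 (0 + (M : ℝ))) := by
    intro x hx y hy hxy
    apply Real.exp_le_exp.mpr
    have := Real.rpow_le_rpow hx.1 hxy hl0.le
    nlinarith
  have h1 := AntitoneOn.sum_le_integral hanti
  simp only [zero_add] at h1
  refine h1.trans ?_
  rw [intervalIntegral.integral_of_le (by positivity)]
  apply MeasureTheory.setIntegral_mono_set
  · have hne : ∫ x in Set.Ioi (0:ℝ), Real.exp (-s * x ^ l) ≠ 0 := by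
      rw [integral_exp_neg_mul_rpow hl0 hs]
      have : 0 < Real.Gamma (1 / l + 1) := Real.Gamma_pos_of_pos (by positivity)
      positivity
    by_contra hcon
    exact hne (MeasureTheory.integral_undef hcon)
  · exact Filter.Eventually.of_forall fun x => (Real.exp_pos _).le
  · exact (Set.Ioc_subset_Ioi_self).eventuallyLE

lemma poly_bound {σ : Type*} [Fintype σ] (P : MvPolynomial σ ℤ) (d : ℕ) (hP : P.IsHomogeneous d) :
    ∃ B : ℤ, 0 ≤ B ∧ ∀ (b : σ → ℤ) (M : ℤ), (∀ k, |b k| ≤ M) →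
      |MvPolynomial.eval b P| ≤ B * M ^ d := by
  refine ⟨∑ s ∈ P.support, |P.coeff s|, Finset.sum_nonneg fun _ _ => abs_nonneg _, ?_⟩
  intro b M hb
  rw [MvPolynomial.eval_eq', Finset.sum_mul]
  refine (Finset.abs_sum_le_sum_abs _ _).trans (Finset.sum_le_sum ?_)
  intro s hs
  rw [abs_mul]
  apply mul_le_mul_of_nonneg_left _ (abs_nonneg _)
  rw [Finset.abs_prod]
  have hdeg : ∑ k, s k = d := by
    have := hP (MvPolynomial.mem_support_iff.mp hs)
    rw [Finsupp.weight_apply, Finsupp.sum_fintype _ _ (by simp)] at this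
    simpa using this
  rw [← hdeg, ← Finset.prod_pow_eq_pow_sum]
  apply Finset.prod_le_prod
  · intro k _; exact abs_nonneg _
  · intro k _
    rw [abs_pow]
    exact pow_le_pow_left₀ (abs_nonneg _) (hb k) _

lemma iter_bound {N d : ℕ} (Fp : Fin (N + 1) → MvPolynomial (Fin (N + 1)) ℤ)
    (hhom : ∀ i, (Fp i).IsHomogeneous d) (a : Fin (N + 1) → ℤ) :
    ∃ B : ℤ, 1 ≤ B ∧ ∀ n i, |((Fmap Fp)^[n] a) i| ≤ B ^ ((d + 1) ^ n) := by
  choose B0 hB0 hB using fun i => poly_bound (Fp i) d (hhom i)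
  set B : ℤ := 1 + ∑ i, B0 i + ∑ i, |a i| with hBdef
  have h0 : 0 ≤ ∑ i, B0 i := Finset.sum_nonneg fun i _ => hB0 i
  have h1 : 0 ≤ ∑ i, |a i| := Finset.sum_nonneg fun i _ => abs_nonneg _
  have hB1 : 1 ≤ B := by linarith
  refine ⟨B, hB1, ?_⟩
  intro n
  induction n with
  | zero =>
    intro i
    have := Finset.single_le_sum (f := fun i => |a i|) (fun i _ => abs_nonneg _)
      (Finset.mem_univ i)
    simp only [Function.iterate_zero, id, pow_zero, pow_one]
    linarith
  | succ n ih =>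
    intro i
    rw [Function.iterate_succ_apply']
    have h2 := hB i ((Fmap Fp)^[n] a) _ ih
    have h3 := Finset.single_le_sum (f := B0) (fun i _ => hB0 i) (Finset.mem_univ i)
    calc |Fmap Fp ((Fmap Fp)^[n] a) i| ≤ B0 i * (B ^ ((d + 1) ^ n)) ^ d := h2
      _ ≤ B * (B ^ ((d + 1) ^ n)) ^ d := by
          apply mul_le_mul_of_nonneg_right _ (by positivity)
          linarith
      _ = B ^ (1 + (d + 1) ^ n * d) := by rw [pow_add, pow_mul, pow_one]
      _ ≤ B ^ ((d + 1) ^ (n + 1)) := by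
          apply pow_le_pow_right₀ hB1
          have : 1 ≤ (d + 1) ^ n := Nat.one_le_pow _ _ (by omega)
          rw [pow_succ]; nlinarith

lemma orbit_finite {N : ℕ} (Fp : Fin (N + 1) → MvPolynomial (Fin (N + 1)) ℤ)
    (a : Fin (N + 1) → ℤ) (p : ℕ) (hp : p.Prime) :
    (Set.range fun n : ℕ =>
    Quotient.mk (MulAction.orbitRel (ZMod p)ˣ (Fin (N + 1) → ZMod p))
      (fun i => (((Fmap Fp)^[n] a) i : ZMod p))).Finite := by
  haveI : Fact p.Prime := ⟨hp⟩
  exact Set.toFinite _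

lemma orbitLen_pos {N : ℕ} (Fp : Fin (N + 1) → MvPolynomial (Fin (N + 1)) ℤ)
    (a : Fin (N + 1) → ℤ) (p : ℕ) (hp : p.Prime) : 1 ≤ orbitLen Fp a p := by
  have := (Set.ncard_pos (orbit_finite Fp a p hp)).mpr (Set.range_nonempty _)
  exact this

lemma collision {N : ℕ} (Fp : Fin (N + 1) → MvPolynomial (Fin (N + 1)) ℤ)
    (a : Fin (N + 1) → ℤ) (p : ℕ) (hp : p.Prime) (m : ℕ) (hm : orbitLen Fp a p ≤ m) :
    ∃ i j : ℕ, i < j ∧ j ≤ m ∧ ∀ k l, (p : ℤ) ∣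
      ((Fmap Fp)^[i] a) k * ((Fmap Fp)^[j] a) l - ((Fmap Fp)^[i] a) l * ((Fmap Fp)^[j] a) k := by
  classical
  have hfin := orbit_finite Fp a p hp
  set f := fun n : ℕ => Quotient.mk (MulAction.orbitRel (ZMod p)ˣ (Fin (N + 1) → ZMod p))
      (fun i => (((Fmap Fp)^[n] a) i : ZMod p)) with hf
  have hcard : hfin.toFinset.card < (Finset.range (m + 1)).card := by
    rw [← Set.ncard_eq_toFinset_card _ hfin, Finset.card_range]
    exact Nat.lt_succ_of_le hm
  obtain ⟨x, hx, y, hy, hxy, hfxy⟩ := Finset.exists_ne_map_eq_of_card_lt_of_maps_to hcard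
    (f := f) (fun n _ => by simp)
  have main : ∀ i j : ℕ, f i = f j → ∀ k l, (p : ℤ) ∣
      ((Fmap Fp)^[i] a) k * ((Fmap Fp)^[j] a) l - ((Fmap Fp)^[i] a) l * ((Fmap Fp)^[j] a) k := by
    intro i j hij k l
    have h := Quotient.exact hij
    obtain ⟨u, hu⟩ := h
    have hk := congrFun hu k
    have hl := congrFun hu l
    simp only [Pi.smul_apply, Units.smul_def, smul_eq_mul] at hk hl
    rw [← ZMod.intCast_zmod_eq_zero_iff_dvd] <;> try exact ⟨hp.ne_zero⟩
    push_cast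
    rw [← hk, ← hl]
    ring
  rw [Finset.mem_range] at hx hy
  rcases lt_or_gt_of_ne hxy with h | h
  · exact ⟨x, y, h, by omega, main x y hfxy⟩
  · exact ⟨y, x, h, by omega, main y x hfxy.symm⟩

lemma log_sum_bound {N d : ℕ} (Fp : Fin (N + 1) → MvPolynomial (Fin (N + 1)) ℤ)
    (hhom : ∀ i, (Fp i).IsHomogeneous d) (a : Fin (N + 1) → ℤ)
    (horbit : ∀ m n : ℕ, m < n → ∃ i j : Fin (N + 1),
      ((Fmap Fp)^[m] a) i * ((Fmap Fp)^[n] a) j ≠ ((Fmap Fp)^[m] a) j * ((Fmap Fp)^[n] a) i) :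
    ∃ K : ℕ, 1 ≤ K ∧ ∀ m : ℕ, 1 ≤ m → ∀ S : Finset ℕ,
      (∀ p ∈ S, p.Prime ∧ orbitLen Fp a p ≤ m) → ∑ p ∈ S, Real.log p ≤ ((K ^ m : ℕ) : ℝ) := by
  classical
  obtain ⟨B, hB1, hB⟩ := iter_bound Fp hhom a
  have hex : ∀ i j : ℕ, ∃ D : ℕ, D ≠ 0 ∧ (D : ℤ) ≤ 2 * B ^ (2 * (d + 1) ^ (max i j)) ∧
      (i < j → ∀ p : ℕ, (∀ k l, (p : ℤ) ∣ ((Fmap Fp)^[i] a) k * ((Fmap Fp)^[j] a) l -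
        ((Fmap Fp)^[i] a) l * ((Fmap Fp)^[j] a) k) → p ∣ D) := by
    intro i j
    by_cases hij : i < j
    · obtain ⟨k, l, hkl⟩ := horbit i j hij
      refine ⟨(((Fmap Fp)^[i] a) k * ((Fmap Fp)^[j] a) l -
        ((Fmap Fp)^[i] a) l * ((Fmap Fp)^[j] a) k).natAbs, ?_, ?_, ?_⟩
      · rw [Int.natAbs_ne_zero]; exact sub_ne_zero.mpr hkl
      · rw [Int.natCast_natAbs]
        have hb : ∀ n ≤ max i j, ∀ k, |((Fmap Fp)^[n] a) k| ≤ B ^ ((d + 1) ^ (max i j)) :=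
          fun n hn k => (hB n k).trans (pow_le_pow_right₀ hB1
            (Nat.pow_le_pow_right (by omega) hn))
        have hm : ∀ k l, |((Fmap Fp)^[i] a) k * ((Fmap Fp)^[j] a) l| ≤
            B ^ (2 * (d + 1) ^ (max i j)) := by
          intro k l
          rw [abs_mul, two_mul, pow_add]
          exact mul_le_mul (hb i (le_max_left _ _) k) (hb j (le_max_right _ _) l)
            (abs_nonneg _) (by positivity)
        have := abs_sub (((Fmap Fp)^[i] a) k * ((Fmap Fp)^[j] a) l)
          (((Fmap Fp)^[i] a) l * ((Fmap Fp)^[j] a) k)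
        linarith [hm k l, hm l k]
      · intro _ p hp
        exact Int.natCast_dvd.mp (hp k l)
    · refine ⟨1, one_ne_zero, ?_, fun h => absurd h hij⟩
      have : 1 ≤ B ^ (2 * (d + 1) ^ (max i j)) := one_le_pow₀ hB1
      push_cast; linarith
  choose D hD0 hDle hDdvd using hex
  have hBr : (1 : ℝ) ≤ B := by exact_mod_cast hB1
  have hlB : 0 ≤ Real.log B := Real.log_nonneg hBr
  set Q : ℕ := ⌈1 + 2 * Real.log B⌉₊ with hQ
  have hQle : 1 + 2 * Real.log B ≤ Q := Nat.le_ceil _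
  have hQ1 : 1 ≤ Q := by
    have : (1 : ℝ) ≤ Q := by linarith
    exact_mod_cast this
  refine ⟨4 * (d + 1) * Q, Nat.mul_pos (by positivity) hQ1, ?_⟩
  intro m hm S hS
  set I := Finset.range (m + 1) ×ˢ Finset.range (m + 1) with hI
  have hdvd : ∏ p ∈ S, p ∣ ∏ x ∈ I, D x.1 x.2 := by
    apply Finset.prod_primes_dvd
    · intro p hp; exact (hS p hp).1.prime
    · intro p hp
      obtain ⟨i, j, hij, hjm, h⟩ := collision Fp a p (hS p hp).1 m (hS p hp).2
      exact (hDdvd i j hij p h).trans (Finset.dvd_prod_of_mem (fun x : ℕ × ℕ => D x.1 x.2)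
        (show (i, j) ∈ I by simp [hI]; omega))
  have hle := Nat.le_of_dvd (Finset.prod_pos fun x _ => Nat.pos_of_ne_zero (hD0 x.1 x.2)) hdvd
  have hpos : 0 < ∏ p ∈ S, p := Finset.prod_pos fun p hp => (hS p hp).1.pos
  have hlog : Real.log ((∏ p ∈ S, p : ℕ) : ℝ) ≤ Real.log ((∏ x ∈ I, D x.1 x.2 : ℕ) : ℝ) :=
    Real.log_le_log (by exact_mod_cast hpos) (by exact_mod_cast hle)
  push_cast at hlog
  rw [Real.log_prod (fun p hp => by exact_mod_cast (hS p hp).1.ne_zero),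
    Real.log_prod (fun x _ => by exact_mod_cast hD0 x.1 x.2)] at hlog
  refine hlog.trans ?_
  have hE : (1 : ℝ) ≤ ((d : ℝ) + 1) ^ m := one_le_pow₀ (by linarith [(Nat.cast_nonneg d : (0:ℝ) ≤ d)])
  have hterm : ∀ x ∈ I, Real.log (D x.1 x.2) ≤ ((d : ℝ) + 1) ^ m * Q ^ m := by
    intro x hx
    have hx' : max x.1 x.2 ≤ m := by
      simp [hI] at hx; omega
    have h1 : (D x.1 x.2 : ℤ) ≤ 2 * B ^ (2 * (d + 1) ^ m) := by
      refine (hDle _ _).trans ?_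
      have := pow_le_pow_right₀ hB1 (Nat.mul_le_mul_left 2
        (Nat.pow_le_pow_right (show 0 < d + 1 by omega) hx'))
      linarith
    have h1' : (D x.1 x.2 : ℝ) ≤ 2 * (B : ℝ) ^ (2 * (d + 1) ^ m) := by exact_mod_cast h1
    have hB0 : (0 : ℝ) < B := by linarith
    have h2 : Real.log (D x.1 x.2) ≤ Real.log 2 + (2 * ((d : ℝ) + 1) ^ m) * Real.log B := by
      refine (Real.log_le_log (by exact_mod_cast Nat.pos_of_ne_zero (hD0 _ _)) h1').trans ?_
      rw [Real.log_mul (by norm_num) (by positivity), Real.log_pow]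
      push_cast
      exact le_rfl
    have h3 : Real.log 2 ≤ 1 := by
      have := Real.log_two_lt_d9; linarith
    have h4 : (Q : ℝ) ≤ (Q : ℝ) ^ m := by
      exact le_self_pow₀ (by exact_mod_cast hQ1) (by omega)
    calc Real.log (D x.1 x.2) ≤ Real.log 2 + (2 * ((d : ℝ) + 1) ^ m) * Real.log B := h2
      _ ≤ ((d : ℝ) + 1) ^ m * (1 + 2 * Real.log B) := by linarith
      _ ≤ ((d : ℝ) + 1) ^ m * Q ^ m := by
          apply mul_le_mul_of_nonneg_left _ (by positivity)
          linarith
  have hcard : I.card ≤ 4 ^ m := by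
    rw [hI, Finset.card_product, Finset.card_range]
    have : m + 1 ≤ 2 ^ m := Nat.lt_two_pow_self
    calc (m + 1) * (m + 1) ≤ 2 ^ m * 2 ^ m := Nat.mul_le_mul this this
      _ = 4 ^ m := by rw [← mul_pow]; norm_num
  have hcard' : (I.card : ℝ) ≤ 4 ^ m := by exact_mod_cast hcard
  calc ∑ x ∈ I, Real.log (D x.1 x.2) ≤ I.card • (((d : ℝ) + 1) ^ m * Q ^ m) :=
        Finset.sum_le_card_nsmul _ _ _ hterm
    _ = I.card * (((d : ℝ) + 1) ^ m * Q ^ m) := by rw [nsmul_eq_mul]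
    _ ≤ 4 ^ m * (((d : ℝ) + 1) ^ m * Q ^ m) :=
        mul_le_mul_of_nonneg_right hcard' (by positivity)
    _ = (((4 * (d + 1) * Q) ^ m : ℕ) : ℝ) := by push_cast; rw [mul_pow, mul_pow, mul_assoc]

theorem stmt4 (N d : ℕ) (hN : 1 ≤ N) (hd : 2 ≤ d)
    (Fp : Fin (N + 1) → MvPolynomial (Fin (N + 1)) ℤ)
    (hhom : ∀ i, (Fp i).IsHomogeneous d)
    (hzero : ∀ x : Fin (N + 1) → AlgebraicClosure ℚ,
      (∀ i, MvPolynomial.aeval x (Fp i) = 0) → x = 0)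
    (a : Fin (N + 1) → ℤ)
    (hcop : Finset.univ.gcd a = 1)
    (horbit : ∀ m n : ℕ, m < n → ∃ i j : Fin (N + 1),
      ((Fmap Fp)^[m] a) i * ((Fmap Fp)^[n] a) j ≠ ((Fmap Fp)^[m] a) j * ((Fmap Fp)^[n] a) i)
    (l : ℝ) (hl : 1 ≤ l) :
    ∃ C : ℝ, 0 < C ∧ ∀ s : ℝ, 0 < s →
      Summable (fun p : {p : ℕ // GoodPrime Fp p} =>
        Real.log p.1 / ((p.1 : ℝ) * Real.exp (s * (orbitLen Fp a p.1 : ℝ) ^ l))) ∧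
      (∑' p : {p : ℕ // GoodPrime Fp p},
          Real.log p.1 / ((p.1 : ℝ) * Real.exp (s * (orbitLen Fp a p.1 : ℝ) ^ l)))
        ≤ C * s ^ (-1 / l) := by
  classical
  obtain ⟨K, hK1, hK⟩ := log_sum_bound Fp hhom a horbit
  set C : ℝ := Real.log K + Real.log 4 + 1 with hC
  have hlK : 0 ≤ Real.log K := Real.log_natCast_nonneg K
  have hl4 : 0 < Real.log 4 := Real.log_pos (by norm_num)
  have hCpos : 0 < C := by linarith
  have hl0 : 0 < l := by linarith
  have hG : 0 < Real.Gamma (1 / l + 1) := Real.Gamma_pos_of_pos (by positivity)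
  have hprime : ∀ p : {p : ℕ // GoodPrime Fp p}, p.1.Prime := fun p => p.2.choose.out
  refine ⟨C * Real.Gamma (1 / l + 1), by positivity, ?_⟩
  intro s hs
  have hnn : 0 ≤ (fun p : {p : ℕ // GoodPrime Fp p} =>
        Real.log p.1 / ((p.1 : ℝ) * Real.exp (s * (orbitLen Fp a p.1 : ℝ) ^ l))) := by
    intro p
    exact div_nonneg (Real.log_natCast_nonneg _) (by positivity)
  have hfinite : ∀ T : Finset {p : ℕ // GoodPrime Fp p},
      ∑ p ∈ T, Real.log p.1 / ((p.1 : ℝ) * Real.exp (s * (orbitLen Fp a p.1 : ℝ) ^ l)) ≤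
        C * Real.Gamma (1 / l + 1) * s ^ (-1 / l) := by
    intro T
    have hA : ∀ k : ℕ, ∑ p ∈ T with orbitLen Fp a p.1 ≤ k, Real.log p.1 / (p.1 : ℝ) ≤ C * k := by
      intro k
      rcases Nat.eq_zero_or_pos k with rfl | hk
      · rw [Finset.filter_false_of_mem]
        · simp
        · intro p _
          have := orbitLen_pos Fp a p.1 (hprime p)
          omega
      · set S := (T.filter fun p => orbitLen Fp a p.1 ≤ k).map (Function.Embedding.subtype _)
          with hSdef
        have hS : ∀ p ∈ S, p.Prime ∧ orbitLen Fp a p ≤ k := by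
          intro p hp
          rw [hSdef, Finset.mem_map] at hp
          obtain ⟨q, hq, rfl⟩ := hp
          exact ⟨hprime q, (Finset.mem_filter.mp hq).2⟩
        have h1 := sum_log_div_le S (fun p hp => (hS p hp).1) (K ^ k) (Nat.one_le_pow _ _ hK1)
          (hK k hk S hS)
        rw [hSdef, Finset.sum_map] at h1
        simp only [Function.Embedding.subtype_apply] at h1
        refine h1.trans ?_
        push_cast
        rw [Real.log_pow]
        have hk' : (1 : ℝ) ≤ k := by exact_mod_cast hk
        rw [hC]
        nlinarith
    set g : ℕ → ℝ := fun k => Real.exp (-s * (k : ℝ) ^ l) with hg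
    have hganti : Antitone g := by
      intro x y hxy
      apply Real.exp_le_exp.mpr
      have : (x : ℝ) ^ l ≤ (y : ℝ) ^ l :=
        Real.rpow_le_rpow (by positivity) (by exact_mod_cast hxy) hl0.le
      nlinarith
    set M := T.sup fun p => orbitLen Fp a p.1 with hM
    have hTM : (T.filter fun p => orbitLen Fp a p.1 ≤ M) = T := by
      apply Finset.filter_true_of_mem
      intro p hp
      exact Finset.le_sup (f := fun p : {p : ℕ // GoodPrime Fp p} => orbitLen Fp a p.1) hp
    have hab := abel_bound T (fun p => Real.log p.1 / (p.1 : ℝ)) (fun p => orbitLen Fp a p.1) C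
      hA g hganti M
    have hAM := hA M
    rw [hTM] at hab hAM
    have hgM : 0 ≤ g M := (Real.exp_pos _).le
    have hrest := mul_nonneg (sub_nonneg.mpr hAM) hgM
    have hsum := mul_le_mul_of_nonneg_left (sum_exp_le l s hl hs M) hCpos.le
    have heq : ∑ p ∈ T, Real.log p.1 / ((p.1 : ℝ) * Real.exp (s * (orbitLen Fp a p.1 : ℝ) ^ l)) =
        ∑ p ∈ T, Real.log p.1 / (p.1 : ℝ) * g (orbitLen Fp a p.1) := by
      apply Finset.sum_congr rfl
      intro p _
      simp only [hg]
      rw [neg_mul, Real.exp_neg, ← div_div, div_eq_mul_inv _ (Real.exp _)]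
    rw [heq]
    calc _ ≤ C * ∑ k ∈ Finset.range M, g (k + 1) := by linarith
      _ ≤ C * (s ^ (-1 / l) * Real.Gamma (1 / l + 1)) := hsum
      _ = _ := by ring
  exact ⟨summable_of_sum_le hnn hfinite, Real.tsum_le_of_sum_le hnn hfinite⟩
end
end

section
/- There is a constant C > 0 (depending on K, N, F₀,…,F_N, and α) such that for every good prime ideal 𝔭 of 𝓞_K: m_𝔭(φ,P) ≥ C·log(log N𝔭). -/
open MvPolynomial NumberField Filter Topology

noncomputable section

/-- The map on integral vectors induced by the homogeneous polynomials `Fp i`. -/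
def FmapK (K : Type) [Field K] [NumberField K] {N : ℕ}
    (Fp : Fin (N + 1) → MvPolynomial (Fin (N + 1)) (𝓞 K)) :
    (Fin (N + 1) → 𝓞 K) → (Fin (N + 1) → 𝓞 K) :=
  fun b i => MvPolynomial.eval b (Fp i)

/-- A nonzero prime ideal `p` of `𝓞 K` is good (for `Fp` and `α`) if `p` does not contain the
ideal generated by the coordinates of `α`, and the reductions of the `Fp i` modulo `p` have no
common zero in an algebraic closure of the residue field `𝓞 K ⧸ p` other than the origin. -/
def GoodIdeal (K : Type) [Field K] [NumberField K] {N : ℕ}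
    (Fp : Fin (N + 1) → MvPolynomial (Fin (N + 1)) (𝓞 K))
    (α : Fin (N + 1) → 𝓞 K) (p : Ideal (𝓞 K)) : Prop :=
  p.IsPrime ∧ p ≠ ⊥ ∧ ¬ (Ideal.span (Set.range α) ≤ p) ∧
  ∃ hm : p.IsMaximal,
    letI : Field ((𝓞 K) ⧸ p) := @Ideal.Quotient.field _ _ p hm
    ∀ x : Fin (N + 1) → AlgebraicClosure ((𝓞 K) ⧸ p),
      (∀ i, MvPolynomial.aeval x ((Fp i).map (Ideal.Quotient.mk p)) = 0) → x = 0

/-- The number of distinct points of `ℙ^N(𝔽_p)` represented by the reductions mod `p` of the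
iterates `F^[n](α)`, i.e. the size of the orbit of `P mod p`. -/
def orbitLenK (K : Type) [Field K] [NumberField K] {N : ℕ}
    (Fp : Fin (N + 1) → MvPolynomial (Fin (N + 1)) (𝓞 K))
    (α : Fin (N + 1) → 𝓞 K) (p : Ideal (𝓞 K)) : ℕ :=
  Set.ncard (Set.range fun n : ℕ =>
    Quotient.mk (MulAction.orbitRel ((𝓞 K) ⧸ p)ˣ (Fin (N + 1) → (𝓞 K) ⧸ p))
      (fun i => Ideal.Quotient.mk p (((FmapK K Fp)^[n] α) i)))

/-- Size of a homogeneous polynomial under a ring hom to `ℂ`. -/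
theorem aux_poly_bound {R : Type*} [CommRing R] {n d : ℕ} (f : MvPolynomial (Fin n) R)
    (hf : f.IsHomogeneous d) (σ : R →+* ℂ) (b : Fin n → R) (H : ℝ) 
    (hb : ∀ i, ‖σ (b i)‖ ≤ H) :
    ‖σ (MvPolynomial.eval b f)‖ ≤ (∑ s ∈ f.support, ‖σ (f.coeff s)‖) * H ^ d := by
  rw [MvPolynomial.eval_eq, map_sum, Finset.sum_mul]
  refine (norm_sum_le _ _).trans (Finset.sum_le_sum fun s hs => ?_)
  rw [map_mul, norm_mul, map_prod, norm_prod]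
  refine mul_le_mul_of_nonneg_left ?_ (norm_nonneg _)
  have hdeg : ∑ i ∈ s.support, s i = d := by
    have := hf (MvPolynomial.mem_support_iff.mp hs)
    rw [← this, Finsupp.weight_apply, Finsupp.sum]
    simp
  rw [← hdeg, ← Finset.prod_pow_eq_pow_sum]
  refine Finset.prod_le_prod (fun _ _ => norm_nonneg _) fun i _ => ?_
  rw [map_pow, norm_pow]
  exact pow_le_pow_left₀ (norm_nonneg _) (hb i) _

theorem aux_orbit_bound (K : Type) [Field K] [NumberField K] {N d : ℕ}
    (Fp : Fin (N + 1) → MvPolynomial (Fin (N + 1)) (𝓞 K))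
    (hhom : ∀ i, (Fp i).IsHomogeneous d) (α : Fin (N + 1) → 𝓞 K) :
    ∃ M : ℝ, 2 ≤ M ∧ ∀ (σ : K →ₐ[ℚ] ℂ) (n : ℕ) (i : Fin (N + 1)),
      ‖σ (((FmapK K Fp)^[n] α) i : K)‖ ≤ M ^ ((d + 1) ^ n) := by
  let S : (K →ₐ[ℚ] ℂ) → (𝓞 K →+* ℂ) := fun σ => (σ : K →+* ℂ).comp (algebraMap (𝓞 K) K)
  let A : (K →ₐ[ℚ] ℂ) → Fin (N + 1) → ℝ := fun σ i =>
    ∑ s ∈ (Fp i).support, ‖S σ ((Fp i).coeff s)‖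
  let B : (K →ₐ[ℚ] ℂ) → Fin (N + 1) → ℝ := fun σ i => ‖S σ (α i)‖
  have hA0 : ∀ σ i, 0 ≤ A σ i := fun σ i => Finset.sum_nonneg fun _ _ => norm_nonneg _
  have hB0 : ∀ σ i, 0 ≤ B σ i := fun σ i => norm_nonneg _
  let M : ℝ := 2 + (∑ σ, ∑ i, (A σ i + B σ i))
  have hle : ∀ σ i, A σ i + B σ i ≤ ∑ σ, ∑ i, (A σ i + B σ i) := fun σ i =>
    (Finset.single_le_sum (f := fun i => A σ i + B σ i)
      (fun j _ => add_nonneg (hA0 σ j) (hB0 σ j)) (Finset.mem_univ i)).trans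
    (Finset.single_le_sum (f := fun σ => ∑ i, (A σ i + B σ i))
      (fun τ _ => Finset.sum_nonneg fun j _ => add_nonneg (hA0 τ j) (hB0 τ j))
      (Finset.mem_univ σ))
  have hM2 : 2 ≤ M := by
    have : 0 ≤ ∑ σ, ∑ i, (A σ i + B σ i) :=
      Finset.sum_nonneg fun τ _ => Finset.sum_nonneg fun j _ => add_nonneg (hA0 τ j) (hB0 τ j)
    simp only [M]; linarith
  refine ⟨M, hM2, fun σ n => ?_⟩
  change ∀ i, ‖S σ (((FmapK K Fp)^[n] α) i)‖ ≤ M ^ ((d + 1) ^ n)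
  induction n with
  | zero =>
    intro i
    have h1 := hle σ i
    have h2 := hA0 σ i
    have : B σ i ≤ M := by simp only [M]; linarith
    simpa [B] using this
  | succ n ih =>
    intro i
    rw [Function.iterate_succ_apply']
    have h := aux_poly_bound (Fp i) (hhom i) (S σ) _ _ ih
    refine (le_trans h ?_)
    have hAM : A σ i ≤ M := by
      have h1 := hle σ i
      have h2 := hB0 σ i
      simp only [M]; linarith
    have hM1 : (1 : ℝ) ≤ M := by linarith
    calc A σ i * (M ^ (d + 1) ^ n) ^ d ≤ M ^ ((d + 1) ^ n) * (M ^ (d + 1) ^ n) ^ d := by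
          refine mul_le_mul_of_nonneg_right (hAM.trans ?_) (by positivity)
          exact le_self_pow₀ hM1 (by positivity)
      _ = M ^ (d + 1) ^ (n + 1) := by
          rw [← pow_mul, ← pow_add]; congr 1; ring

theorem aux_norm_le (K : Type) [Field K] [NumberField K] (p : Ideal (𝓞 K)) (x : 𝓞 K)
    (hx : x ∈ p) (hx0 : x ≠ 0) (T : ℝ) (hT : ∀ σ : K →ₐ[ℚ] ℂ, ‖σ (x : K)‖ ≤ T) :
    (Ideal.absNorm p : ℝ) ≤ T ^ Module.finrank ℚ K := by
  have h1 : Ideal.absNorm p ∣ (Algebra.norm ℤ x).natAbs := by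
    rw [← Ideal.absNorm_span_singleton]
    exact Ideal.absNorm_dvd_absNorm_of_le ((Ideal.span_singleton_le_iff_mem _).2 hx)
  have h2 : Ideal.absNorm p ≤ (Algebra.norm ℤ x).natAbs :=
    Nat.le_of_dvd (Int.natAbs_pos.2 (by simpa [Algebra.norm_eq_zero_iff] using hx0)) h1
  have h3 : ((Algebra.norm ℤ x).natAbs : ℝ) = ‖∏ σ : K →ₐ[ℚ] ℂ, σ (x : K)‖ := by
    rw [← Algebra.norm_eq_prod_embeddings ℚ ℂ (x : K), ← Algebra.coe_norm_int]
    simp [Nat.cast_natAbs]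
  calc (Ideal.absNorm p : ℝ) ≤ ((Algebra.norm ℤ x).natAbs : ℝ) := by exact_mod_cast h2
    _ = ∏ σ : K →ₐ[ℚ] ℂ, ‖σ (x : K)‖ := by rw [h3, norm_prod]
    _ ≤ ∏ σ : K →ₐ[ℚ] ℂ, T := Finset.prod_le_prod (fun _ _ => norm_nonneg _) fun σ _ => hT σ
    _ = T ^ Module.finrank ℚ K := by
      rw [Finset.prod_const, Finset.card_univ, AlgHom.card]

theorem aux_collision (K : Type) [Field K] [NumberField K] {N : ℕ}
    (Fp : Fin (N + 1) → MvPolynomial (Fin (N + 1)) (𝓞 K))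
    (α : Fin (N + 1) → 𝓞 K) (p : Ideal (𝓞 K)) (hp : p ≠ ⊥) :
    0 < orbitLenK K Fp α p ∧ ∃ m n : ℕ, m < n ∧ n ≤ orbitLenK K Fp α p ∧
      ∀ i j, ((FmapK K Fp)^[m] α) i * ((FmapK K Fp)^[n] α) j -
        ((FmapK K Fp)^[m] α) j * ((FmapK K Fp)^[n] α) i ∈ p := by
  haveI : Finite (𝓞 K ⧸ p) := Ideal.finiteQuotientOfFreeOfNeBot p hp
  let g : ℕ → Quotient (MulAction.orbitRel ((𝓞 K) ⧸ p)ˣ (Fin (N + 1) → (𝓞 K) ⧸ p)) := fun n =>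
    Quotient.mk _ (fun i => Ideal.Quotient.mk p (((FmapK K Fp)^[n] α) i))
  have hfin : (Set.range g).Finite := Set.toFinite _
  have hlen : orbitLenK K Fp α p = hfin.toFinset.card := Set.ncard_eq_toFinset_card _ hfin
  refine ⟨?_, ?_⟩
  · rw [hlen, Finset.card_pos]
    exact ⟨g 0, by simp⟩
  have key : ∀ m n : ℕ, g m = g n → ∀ i j, ((FmapK K Fp)^[m] α) i * ((FmapK K Fp)^[n] α) j -
        ((FmapK K Fp)^[m] α) j * ((FmapK K Fp)^[n] α) i ∈ p := by
    intro m n hmn i j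
    obtain ⟨u, hu⟩ := MulAction.orbitRel_apply.1 (Quotient.exact hmn)
    have hu' : ∀ i, (u : 𝓞 K ⧸ p) * Ideal.Quotient.mk p (((FmapK K Fp)^[n] α) i) =
        Ideal.Quotient.mk p (((FmapK K Fp)^[m] α) i) := fun i => congrFun hu i
    rw [← Ideal.Quotient.eq_zero_iff_mem, map_sub, map_mul, map_mul, ← hu' i, ← hu' j]
    ring
  obtain ⟨a, ha, b, hb, hab, hgab⟩ := Finset.exists_ne_map_eq_of_card_lt_of_maps_to
    (s := Finset.range (orbitLenK K Fp α p + 1)) (t := hfin.toFinset) (f := g)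
    (by rw [Finset.card_range, hlen]; omega) (fun x _ => by simp)
  rw [Finset.mem_range] at ha hb
  rcases lt_or_gt_of_ne hab with h | h
  · exact ⟨a, b, h, by omega, key a b hgab⟩
  · exact ⟨b, a, h, by omega, key b a hgab.symm⟩

theorem stmt6 (K : Type) [Field K] [NumberField K] (N d : ℕ) (hN : 1 ≤ N) (hd : 2 ≤ d)
    (Fp : Fin (N + 1) → MvPolynomial (Fin (N + 1)) (𝓞 K))
    (hhom : ∀ i, (Fp i).IsHomogeneous d)
    (hzero : ∀ x : Fin (N + 1) → AlgebraicClosure K,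
      (∀ i, MvPolynomial.aeval x ((Fp i).map (algebraMap (𝓞 K) K)) = 0) → x = 0)
    (α : Fin (N + 1) → 𝓞 K) (hα : α ≠ 0)
    (horbit : ∀ m n : ℕ, m < n → ∃ i j : Fin (N + 1),
      ((FmapK K Fp)^[m] α) i * ((FmapK K Fp)^[n] α) j ≠
        ((FmapK K Fp)^[m] α) j * ((FmapK K Fp)^[n] α) i) :
    ∃ C : ℝ, 0 < C ∧ ∀ p : Ideal (𝓞 K), GoodIdeal K Fp α p →
      C * Real.log (Real.log (Ideal.absNorm p)) ≤ (orbitLenK K Fp α p : ℝ) := by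
  obtain ⟨M, hM2, hM⟩ := aux_orbit_bound K Fp hhom α
  set D := Module.finrank ℚ K with hD
  have hDpos : 0 < D := Module.finrank_pos
  have hlogM : 0 < Real.log M := Real.log_pos (by linarith)
  have hlogd : 0 < Real.log (d + 1) := Real.log_pos (by
    have : (2 : ℝ) ≤ d := by exact_mod_cast hd
    linarith)
  set E : ℝ := Real.log (d + 1) + |Real.log (3 * D * Real.log M)| with hE
  have hEpos : 0 < E := by positivity
  refine ⟨E⁻¹, by positivity, fun p hp => ?_⟩
  obtain ⟨hprime, hbot, -, -⟩ := hp
  obtain ⟨hpos, m, n, hmn, hnl, hmem⟩ := aux_collision K Fp α p hbot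
  set l := orbitLenK K Fp α p with hl
  obtain ⟨i, j, hij⟩ := horbit m n hmn
  have hM1 : (1 : ℝ) ≤ M := by linarith
  have hb : ∀ σ : K →ₐ[ℚ] ℂ, ∀ k ≤ l, ∀ i, ‖σ (((FmapK K Fp)^[k] α) i : K)‖ ≤ M ^ ((d + 1) ^ l) :=
    fun σ k hk i => (hM σ k i).trans (pow_le_pow_right₀ hM1 (Nat.pow_le_pow_right (by omega) hk))
  have hnorm := aux_norm_le K p _ (hmem i j) (sub_ne_zero.2 hij) (M ^ (3 * (d + 1) ^ l)) (by
    intro σ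
    have e : M ^ (3 * (d + 1) ^ l) = M ^ ((d + 1) ^ l) * (M ^ ((d + 1) ^ l) * M ^ ((d + 1) ^ l)) := by
      ring
    have hq : 2 ≤ M ^ ((d + 1) ^ l) := hM2.trans (le_self_pow₀ hM1 (by positivity))
    rw [e]
    set Q := M ^ ((d + 1) ^ l)
    have hml : m ≤ l := by omega
    push_cast [map_sub, map_mul]
    refine (norm_sub_le _ _).trans ?_
    rw [norm_mul, norm_mul]
    have h1 := mul_le_mul (hb σ m hml i) (hb σ n hnl j) (norm_nonneg _) (by linarith)
    have h2 := mul_le_mul (hb σ m hml j) (hb σ n hnl i) (norm_nonneg _) (by linarith)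
    have h3 : 0 ≤ Q * Q := by positivity
    nlinarith)
  have hN2 : 1 < Ideal.absNorm p := by
    have h0 : Ideal.absNorm p ≠ 0 := by
      rwa [Ne, Ideal.absNorm_eq_zero_iff]
    have h1 : Ideal.absNorm p ≠ 1 := by
      rw [Ne, Ideal.absNorm_eq_one_iff]; exact hprime.ne_top
    omega
  have hN2' : (1 : ℝ) < Ideal.absNorm p := by exact_mod_cast hN2
  have hlog : Real.log (Ideal.absNorm p) ≤ (d + 1 : ℝ) ^ l * (3 * D * Real.log M) := by
    refine (Real.log_le_log (by linarith) hnorm).trans (le_of_eq ?_)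
    rw [Real.log_pow, Real.log_pow]; push_cast; ring
  have hl1 : (1 : ℝ) ≤ l := by exact_mod_cast hpos
  have hll : Real.log (Real.log (Ideal.absNorm p)) ≤ E * l := by
    refine (Real.log_le_log (Real.log_pos hN2') hlog).trans ?_
    rw [Real.log_mul (by positivity) (by positivity), Real.log_pow, hE]
    have := le_abs_self (Real.log (3 * D * Real.log M))
    nlinarith [abs_nonneg (Real.log (3 * D * Real.log M))]
  rw [inv_mul_le_iff₀ hEpos]
  exact hll
end
end

section
/- There is a constant C > 0 depending only on K and N (one may take C = 2^{[K:ℚ]}·binomial(N+1,2)^{[K:ℚ]}) with the following property. Let α = (α₀,…,α_N) and β = (β₀,…,β_N) be nonzero vectors in 𝓞_K^{N+1} that represent distinct points of ℙ^N(K) (i.e., α and β are not K-scalar multiples of one another), and let 𝔇 be the ideal of 𝓞_K generated by all α_i·β_j − α_j·β_i for 0 ≤ i < j ≤ N. Then 𝔇 is nonzero and N(𝔇) ≤ C · ∏_{w} (max_{0≤i≤N} w(α_i))^{m_w} · ∏_{w} (max_{0≤i≤N} w(β_i))^{m_w}, where the products run over the infinite places w of K, w(·) denotes the associated absolute value on K,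 and m_w = 1 if w is real and m_w = 2 if w is complex. -/
open NumberField

noncomputable section

theorem stmt8 (K : Type) [Field K] [NumberField K] (N : ℕ) (hN : 1 ≤ N) :
    ∃ C : ℝ, 0 < C ∧
      ∀ α β : Fin (N + 1) → 𝓞 K, α ≠ 0 → β ≠ 0 →
        (∀ c : K,
          (fun i => c * algebraMap (𝓞 K) K (α i)) ≠ fun i => algebraMap (𝓞 K) K (β i)) →
        Ideal.span {x : 𝓞 K | ∃ i j : Fin (N + 1), i < j ∧ x = α i * β j - α j * β i} ≠ ⊥ ∧
        (Ideal.absNorm (Ideal.span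
            {x : 𝓞 K | ∃ i j : Fin (N + 1), i < j ∧ x = α i * β j - α j * β i}) : ℝ) ≤
          C * (∏ w : InfinitePlace K,
                (Finset.univ.sup' ⟨0, Finset.mem_univ 0⟩
                  fun i => w (algebraMap (𝓞 K) K (α i))) ^ w.mult)
            * ∏ w : InfinitePlace K,
                (Finset.univ.sup' ⟨0, Finset.mem_univ 0⟩
                  fun i => w (algebraMap (𝓞 K) K (β i))) ^ w.mult := by
  classical
  refine ⟨∏ w : InfinitePlace K, (2 : ℝ) ^ w.mult, Finset.prod_pos fun w _ => by positivity, ?_⟩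
  intro α β hα hβ h
  set S : Set (𝓞 K) := {x : 𝓞 K | ∃ i j : Fin (N + 1), i < j ∧ x = α i * β j - α j * β i} with hS
  have key : ∃ i j : Fin (N + 1), i < j ∧ α i * β j - α j * β i ≠ 0 := by
    by_contra! hc
    have hall : ∀ i j, α i * β j = α j * β i := by
      intro i j
      rcases lt_trichotomy i j with hij | hij | hij
      · exact sub_eq_zero.mp (hc i j hij)
      · rw [hij]
      · exact (sub_eq_zero.mp (hc j i hij)).symm
    obtain ⟨i, hi⟩ := Function.ne_iff.mp hα
    have hi' : algebraMap (𝓞 K) K (α i) ≠ 0 := by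
      simpa using hi
    apply h (algebraMap (𝓞 K) K (β i) / algebraMap (𝓞 K) K (α i))
    funext j
    have h2 := congrArg (algebraMap (𝓞 K) K) (hall i j)
    rw [map_mul, map_mul] at h2
    rw [div_mul_eq_mul_div, div_eq_iff hi']
    linear_combination -h2
  obtain ⟨i, j, hij, hne⟩ := key
  have hmem : α i * β j - α j * β i ∈ Ideal.span S :=
    Ideal.subset_span ⟨i, j, hij, rfl⟩
  refine ⟨fun hb => hne (by rw [hb] at hmem; simpa using hmem), ?_⟩
  set x := α i * β j - α j * β i with hx
  have h1 : Ideal.absNorm (Ideal.span S) ≤ (Algebra.norm ℤ x).natAbs :=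
    Nat.le_of_dvd (Int.natAbs_pos.mpr (Algebra.norm_ne_zero_iff.mpr hne))
      (by
        rw [← Ideal.absNorm_span_singleton]
        exact Ideal.absNorm_dvd_absNorm_of_le ((Ideal.span_singleton_le_iff_mem _).mpr hmem))
  have h2 : (((Algebra.norm ℤ x).natAbs : ℕ) : ℝ)
      = ∏ w : InfinitePlace K, w (algebraMap (𝓞 K) K x) ^ w.mult := by
    rw [InfinitePlace.prod_eq_abs_norm, Nat.cast_natAbs, ← Algebra.coe_norm_int]
    push_cast
    rfl
  have h3 : (Ideal.absNorm (Ideal.span S) : ℝ) ≤ ((Algebra.norm ℤ x).natAbs : ℕ) := by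
    exact_mod_cast h1
  refine h3.trans ?_
  rw [h2, ← Finset.prod_mul_distrib, ← Finset.prod_mul_distrib]
  refine Finset.prod_le_prod (fun w _ => by positivity) fun w _ => ?_
  rw [← mul_pow, ← mul_pow]
  refine pow_le_pow_left₀ (by positivity) ?_ _
  have hA : ∀ k, w (algebraMap (𝓞 K) K (α k)) ≤ Finset.univ.sup' ⟨0, Finset.mem_univ 0⟩
      fun i => w (algebraMap (𝓞 K) K (α i)) := fun k =>
    Finset.le_sup' (fun i => w (algebraMap (𝓞 K) K (α i))) (Finset.mem_univ k)
  have hB : ∀ k, w (algebraMap (𝓞 K) K (β k)) ≤ Finset.univ.sup' ⟨0, Finset.mem_univ 0⟩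
      fun i => w (algebraMap (𝓞 K) K (β i)) := fun k =>
    Finset.le_sup' (fun i => w (algebraMap (𝓞 K) K (β i))) (Finset.mem_univ k)
  suffices gen : ∀ A B : ℝ, (∀ k, w (algebraMap (𝓞 K) K (α k)) ≤ A) →
      (∀ k, w (algebraMap (𝓞 K) K (β k)) ≤ B) → w (algebraMap (𝓞 K) K x) ≤ 2 * A * B from
    gen _ _ hA hB
  clear hA hB
  intro A B hA hB
  have hA0 : 0 ≤ A := (apply_nonneg w _).trans (hA 0)
  have e1 := mul_le_mul (hA i) (hB j) (apply_nonneg w _) hA0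
  have e2 := mul_le_mul (hA j) (hB i) (apply_nonneg w _) hA0
  have e3 : w (algebraMap (𝓞 K) K x) ≤ w (algebraMap (𝓞 K) K (α i) * algebraMap (𝓞 K) K (β j))
      + w (algebraMap (𝓞 K) K (α j) * algebraMap (𝓞 K) K (β i)) := by
    rw [hx, map_sub, map_mul, map_mul, sub_eq_add_neg]
    refine (w.1.add_le _ _).trans (le_of_eq ?_)
    rw [AbsoluteValue.map_neg]
    rfl
  rw [map_mul, map_mul] at e3
  linarith
end
end

section
/- There exist a constant C > 0, a finite set S of nonzero prime ideals of 𝓞_K containing all primes that are not good, and for each integer m ≥ 1 a nonzero integral ideal 𝔇(m) of 𝓞_K, such that: (i) for every nonzero prime ideal 𝔭 ∉ S, one has m_𝔭(φ,P) ≤ m if and only if 𝔭 divides 𝔇(m); and (ii) for every m ≥ 1, N(𝔇(m)) ≤ exp(exp(C·m)), where N denotes the absolute norm. -/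
open MvPolynomial NumberField Filter Topology

noncomputable section

theorem aux_nullst (K : Type) [Field K] [NumberField K] (N : ℕ)
    (Fp : Fin (N + 1) → MvPolynomial (Fin (N + 1)) (𝓞 K))
    (hzero : ∀ x : Fin (N + 1) → AlgebraicClosure K,
      (∀ i, MvPolynomial.aeval x ((Fp i).map (algebraMap (𝓞 K) K)) = 0) → x = 0)
    (i : Fin (N + 1)) :
    ∃ δ : 𝓞 K, δ ≠ 0 ∧ ∃ e : ℕ, X i ^ e * C δ ∈ Ideal.span (Set.range Fp) := by
  let _ : Algebra (MvPolynomial (Fin (N + 1)) (𝓞 K)) (MvPolynomial (Fin (N + 1)) K) :=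
    MvPolynomial.algebraMvPolynomial
  set I : Ideal (MvPolynomial (Fin (N + 1)) (𝓞 K)) := Ideal.span (Set.range Fp) with hI
  set J := I.map (algebraMap (MvPolynomial (Fin (N + 1)) (𝓞 K)) (MvPolynomial (Fin (N + 1)) K))
    with hJ
  have h1 : (X i : MvPolynomial (Fin (N + 1)) K) ∈ J.radical := by
    rw [← vanishingIdeal_zeroLocus_eq_radical (K := AlgebraicClosure K)]
    intro x hx
    have : x = 0 := by
      apply hzero
      intro j
      apply hx
      exact Ideal.mem_map_of_mem (algebraMap (MvPolynomial (Fin (N + 1)) (𝓞 K)) (MvPolynomial (Fin (N + 1)) K)) (Ideal.subset_span ⟨j, rfl⟩)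
    simp [this]
  obtain ⟨e, he⟩ := h1
  rw [hJ, IsLocalization.mem_map_algebraMap_iff
    ((nonZeroDivisors (𝓞 K)).map (C (σ := Fin (N + 1))))] at he
  obtain ⟨⟨⟨y, hy⟩, ⟨c, δ, hδ, rfl⟩⟩, h⟩ := he
  refine ⟨δ, nonZeroDivisors.ne_zero hδ, e, ?_⟩
  have : X i ^ e * C δ = y := by
    apply MvPolynomial.map_injective (algebraMap (𝓞 K) K) (IsFractionRing.injective _ _)
    rw [map_mul, map_pow, map_X]
    exact h
  rwa [this]

theorem aux_good (K : Type) [Field K] [NumberField K] (N : ℕ)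
    (Fp : Fin (N + 1) → MvPolynomial (Fin (N + 1)) (𝓞 K)) (α : Fin (N + 1) → 𝓞 K)
    (δ : Fin (N + 1) → 𝓞 K) (e : Fin (N + 1) → ℕ)
    (h : ∀ i, X i ^ (e i) * C (δ i) ∈ Ideal.span (Set.range Fp))
    (p : Ideal (𝓞 K)) (hp : p.IsPrime) (hp0 : p ≠ ⊥) (hα : ¬ (Ideal.span (Set.range α) ≤ p))
    (hδ : ∀ i, δ i ∉ p) : GoodIdeal K Fp α p := by
  refine ⟨hp, hp0, hα, hp.isMaximal hp0, ?_⟩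
  intro x hx
  let _ : Field ((𝓞 K) ⧸ p) := @Ideal.Quotient.field _ _ p (hp.isMaximal hp0)
  funext i
  let f : MvPolynomial (Fin (N + 1)) (𝓞 K) →+* AlgebraicClosure ((𝓞 K) ⧸ p) :=
    ((aeval x : MvPolynomial (Fin (N + 1)) ((𝓞 K) ⧸ p) →ₐ[(𝓞 K) ⧸ p] _) : _ →+* _).comp
      (MvPolynomial.map (Ideal.Quotient.mk p))
  have h1 : Ideal.span (Set.range Fp) ≤ RingHom.ker f := by
    rw [Ideal.span_le]
    rintro _ ⟨j, rfl⟩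
    exact hx j
  have h2 : f (X i ^ (e i) * C (δ i)) = 0 := h1 (h i)
  have h3 : x i ^ e i * algebraMap ((𝓞 K) ⧸ p) (AlgebraicClosure ((𝓞 K) ⧸ p)) (Ideal.Quotient.mk p (δ i)) = 0 := by
    simpa [f] using h2
  rcases mul_eq_zero.1 h3 with h4 | h4
  · exact eq_zero_of_pow_eq_zero h4
  · rw [map_eq_zero] at h4
    exact absurd (Ideal.Quotient.eq_zero_iff_mem.1 h4) (hδ i)

theorem aux_finite (K : Type) [Field K] [NumberField K] (x : 𝓞 K) (hx : x ≠ 0) :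
    {p : Ideal (𝓞 K) | p.IsPrime ∧ p ≠ ⊥ ∧ x ∈ p}.Finite := by
  have h := Ideal.finite_factors (I := Ideal.span {x}) (by simpa using hx)
  refine (h.image (fun v => v.asIdeal)).subset ?_
  rintro p ⟨h1, h2, h3⟩
  refine ⟨⟨p, h1, h2⟩, ?_, rfl⟩
  simpa [Ideal.dvd_span_singleton] using h3

theorem aux_S (K : Type) [Field K] [NumberField K] (N : ℕ)
    (Fp : Fin (N + 1) → MvPolynomial (Fin (N + 1)) (𝓞 K))
    (hzero : ∀ x : Fin (N + 1) → AlgebraicClosure K,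
      (∀ i, MvPolynomial.aeval x ((Fp i).map (algebraMap (𝓞 K) K)) = 0) → x = 0)
    (α : Fin (N + 1) → 𝓞 K) (hα : α ≠ 0) :
    ∃ S : Finset (Ideal (𝓞 K)),
      (∀ p : Ideal (𝓞 K), p.IsPrime → p ≠ ⊥ → ¬ GoodIdeal K Fp α p → p ∈ S) := by
  choose δ hδ e he using aux_nullst K N Fp hzero
  obtain ⟨j, hj⟩ := Function.ne_iff.1 hα
  have hfin : ({p : Ideal (𝓞 K) | p.IsPrime ∧ p ≠ ⊥ ∧ α j ∈ p} ∪
    ⋃ i, {p : Ideal (𝓞 K) | p.IsPrime ∧ p ≠ ⊥ ∧ δ i ∈ p}).Finite :=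
    (aux_finite K _ hj).union (Set.finite_iUnion fun i => aux_finite K _ (hδ i))
  refine ⟨hfin.toFinset, ?_⟩
  intro p h1 h2 h3
  rw [Set.Finite.mem_toFinset]
  by_contra hcon
  simp only [Set.mem_union, Set.mem_iUnion, not_or, not_exists, Set.mem_ofPred_eq] at hcon
  apply h3
  refine aux_good K N Fp α δ e he p h1 h2 ?_ fun i hi => hcon.2 i ⟨h1, h2, hi⟩
  intro h
  exact hcon.1 ⟨h1, h2, h (Ideal.subset_span ⟨j, rfl⟩)⟩

theorem aux_house_eval (K : Type) [Field K] [NumberField K] (N d : ℕ)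
    (F : MvPolynomial (Fin (N + 1)) (𝓞 K)) (hF : F.IsHomogeneous d)
    (b : Fin (N + 1) → 𝓞 K) (M : ℝ)
    (hb : ∀ i, house (b i : K) ≤ M) :
    house ((MvPolynomial.eval b F : 𝓞 K) : K) ≤
      (∑ s ∈ F.support, house ((F.coeff s : 𝓞 K) : K)) * M ^ d := by
  change house (algebraMap (𝓞 K) K (MvPolynomial.eval b F)) ≤ _
  rw [eval_eq', map_sum, Finset.sum_mul]
  refine (house_sum_le_sum_house _ _).trans (Finset.sum_le_sum fun s hs => ?_)
  rw [map_mul]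
  refine (house_mul_le _ _).trans (mul_le_mul_of_nonneg_left ?_ (house_nonneg _))
  have hd : ∑ i, s i = d := by
    have := hF (mem_support_iff.1 hs)
    rw [Finsupp.weight_apply, Finsupp.sum_fintype] at this <;> simp_all
  rw [← hd, ← Finset.prod_pow_eq_pow_sum, house, map_prod, map_prod]
  refine (Finset.norm_prod_le _ _).trans (Finset.prod_le_prod (fun _ _ => norm_nonneg _) fun i _ => ?_)
  rw [map_pow, map_pow]
  exact (norm_pow_le _ _).trans (pow_le_pow_left₀ (norm_nonneg _) (hb i) _)

theorem aux_house_iter (K : Type) [Field K] [NumberField K] (N d : ℕ)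
    (Fp : Fin (N + 1) → MvPolynomial (Fin (N + 1)) (𝓞 K))
    (hhom : ∀ i, (Fp i).IsHomogeneous d)
    (α : Fin (N + 1) → 𝓞 K) : ∃ A : ℝ, 2 ≤ A ∧ ∀ n i,
      house (((FmapK K Fp)^[n] α) i : K) ≤ A ^ ((d + 1) ^ n) := by
  let A : ℝ := 2 + ∑ i, house (α i : K) + ∑ i, ∑ s ∈ (Fp i).support, house (((Fp i).coeff s : 𝓞 K) : K)
  have hn1 : 0 ≤ ∑ i, house (α i : K) := Finset.sum_nonneg fun i _ => house_nonneg _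
  have hn2' : ∀ i, 0 ≤ ∑ s ∈ (Fp i).support, house (((Fp i).coeff s : 𝓞 K) : K) :=
    fun i => Finset.sum_nonneg fun i _ => house_nonneg _
  have hn2 : 0 ≤ ∑ i, ∑ s ∈ (Fp i).support, house (((Fp i).coeff s : 𝓞 K) : K) :=
    Finset.sum_nonneg fun i _ => hn2' i
  have hA : 2 ≤ A := by simp only [A]; linarith
  refine ⟨A, hA, ?_⟩
  intro n
  induction n with
  | zero =>
    intro i
    have := Finset.single_le_sum (f := fun i => house (α i : K)) (fun i _ => house_nonneg _) (Finset.mem_univ i)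
    simp only [pow_zero, pow_one, Function.iterate_zero, id, A]
    linarith
  | succ n ih =>
    intro i
    rw [Function.iterate_succ_apply']
    refine (aux_house_eval K N d (Fp i) (hhom i) _ _ ih).trans ?_
    have := Finset.single_le_sum (f := fun i => ∑ s ∈ (Fp i).support, house (((Fp i).coeff s : 𝓞 K) : K)) (fun i _ => hn2' i) (Finset.mem_univ i)
    have h2 : ∑ s ∈ (Fp i).support, house (((Fp i).coeff s : 𝓞 K) : K) ≤ A := by
      simp only [A]; linarith
    calc _ ≤ A * (A ^ (d + 1) ^ n) ^ d := by gcongr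
      _ = A ^ ((d + 1) ^ n * d + 1) := by rw [pow_succ, ← pow_mul]; ring
      _ ≤ _ := by
        apply pow_le_pow_right₀ (by linarith)
        rw [pow_succ]
        have : 1 ≤ (d + 1) ^ n := Nat.one_le_pow _ _ (by omega)
        nlinarith

theorem aux_norm (K : Type) [Field K] [NumberField K] (I : Ideal (𝓞 K)) (x : 𝓞 K) (hx : x ≠ 0)
    (hI : x ∈ I) : (Ideal.absNorm I : ℝ) ≤ house (x : K) ^ (Module.finrank ℚ K) := by
  have h1 : Ideal.absNorm I ≤ Ideal.absNorm (Ideal.span {x}) := by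
    apply Nat.le_of_dvd
    · rw [Nat.pos_iff_ne_zero, Ne, Ideal.absNorm_eq_zero_iff]
      simpa using hx
    · exact Ideal.absNorm_dvd_absNorm_of_le (by simpa [Ideal.span_le] using hI)
  obtain ⟨σ⟩ : Nonempty (K →+* ℂ) := inferInstance
  have h2 := norm_norm_le_norm_mul_house_pow (x : K) σ
  have h3 : (Ideal.absNorm (Ideal.span {x}) : ℝ) = ‖Algebra.norm ℚ (x : K)‖ := by
    rw [Ideal.absNorm_span_singleton, ← Algebra.coe_norm_int, Nat.cast_natAbs, Int.cast_abs]
    simp [Int.norm_eq_abs]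
  calc (Ideal.absNorm I : ℝ) ≤ Ideal.absNorm (Ideal.span {x}) := by exact_mod_cast h1
    _ ≤ house (x : K) * house (x : K) ^ (Module.finrank ℚ K - 1) := by
      rw [h3]
      refine h2.trans ?_
      have := norm_embedding_le_house (x : K) σ
      have := house_nonneg (x : K)
      gcongr
    _ = _ := by
      rw [← pow_succ', Nat.sub_add_cancel]
      exact Module.finrank_pos

theorem aux_count {T : Type} [Finite T] (Q : ℕ → T)
    (step : ∀ i j, Q i = Q j → Q (i + 1) = Q (j + 1)) (m : ℕ) :
    (Set.range Q).ncard ≤ m ↔ ∃ i j, i < j ∧ j ≤ m ∧ Q i = Q j := by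
  constructor
  · intro h
    by_contra hcon
    push Not at hcon
    have hinj : Set.InjOn Q (Finset.range (m + 1) : Set ℕ) := by
      intro i hi j hj hij
      simp only [Finset.coe_range, Set.mem_Iio] at hi hj
      rcases lt_trichotomy i j with hlt | heq | hgt
      · exact absurd hij (hcon i j hlt (by omega))
      · exact heq
      · exact absurd hij.symm (hcon j i hgt (by omega))
    have h1 := hinj.ncard_image
    rw [Set.ncard_coe_finset, Finset.card_range] at h1
    have h2 := Set.ncard_le_ncard (Set.image_subset_range Q (Finset.range (m + 1) : Set ℕ))
      (Set.toFinite _)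
    omega
  · rintro ⟨i, j, hij, hjm, hQ⟩
    have hadd : ∀ t, Q (i + t) = Q (j + t) := by
      intro t
      induction t with
      | zero => exact hQ
      | succ t ih => exact step _ _ ih
    have hsub : Set.range Q ⊆ Q '' (Finset.range j : Set ℕ) := by
      rintro _ ⟨n, rfl⟩
      induction n using Nat.strong_induction_on with
      | _ n ih =>
        by_cases hn : n < j
        · exact ⟨n, by simpa using hn, rfl⟩
        · have := hadd (n - j)
          rw [Nat.add_sub_cancel' (by omega)] at this
          rw [← this]
          exact ih _ (by omega)
    have h1 := Set.ncard_le_ncard hsub (Set.toFinite _)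
    have h2 := Set.ncard_image_le (f := Q) (s := (Finset.range j : Set ℕ)) (Set.toFinite _)
    rw [Set.ncard_coe_finset, Finset.card_range] at h2
    omega

theorem aux_eval_smul {R : Type} [CommRing R] {n d : ℕ} (F : MvPolynomial (Fin n) R)
    (hF : F.IsHomogeneous d) (c : R) (v : Fin n → R) :
    eval (c • v) F = c ^ d * eval v F := by
  rw [eval_eq', eval_eq', Finset.mul_sum]
  refine Finset.sum_congr rfl fun s hs => ?_
  have hd : ∑ i, s i = d := by
    have := hF (mem_support_iff.1 hs)
    rw [Finsupp.weight_apply, Finsupp.sum_fintype] at this <;> simp_all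
  simp only [Pi.smul_apply, smul_eq_mul, mul_pow, Finset.prod_mul_distrib]
  rw [Finset.prod_pow_eq_pow_sum, hd]
  ring

theorem aux_minors {k : Type} [CommRing k] (hk : IsField k) {n : ℕ} (v w : Fin n → k)
    (hv : v ≠ 0) (hw : w ≠ 0) :
    (∃ u : kˣ, u • w = v) ↔ ∀ a b, v a * w b = v b * w a := by
  constructor
  · rintro ⟨u, rfl⟩ a b
    simp only [Pi.smul_apply, Units.smul_def, smul_eq_mul]
    ring
  · intro h
    let _ := hk.toField
    obtain ⟨b, hb⟩ := Function.ne_iff.1 hw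
    have hb : w b ≠ 0 := hb
    have hvb : v b ≠ 0 := by
      intro h0
      apply hv
      funext a
      have := h a b
      rw [h0, zero_mul] at this
      exact (mul_eq_zero.1 this).resolve_right hb
    refine ⟨Units.mk0 (v b) hvb * (Units.mk0 (w b) hb)⁻¹, ?_⟩
    funext a
    simp only [Pi.smul_apply, Units.smul_def, smul_eq_mul]
    simp only [Units.val_mul, Units.val_mk0, Units.val_inv_eq_inv_val]
    have := h a b
    field_simp
    linear_combination -this

/-- The ideal generated by the two by two minors of the vectors `x`, `y`. -/
def auxMinor (K : Type) [Field K] [NumberField K] {N : ℕ} (x y : Fin (N + 1) → 𝓞 K) :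
    Ideal (𝓞 K) :=
  Ideal.span (Set.range fun ab : Fin (N + 1) × Fin (N + 1) => x ab.1 * y ab.2 - x ab.2 * y ab.1)

/-- The product of the minor ideals of all pairs among the first `m + 1` iterates. -/
def auxD (K : Type) [Field K] [NumberField K] {N : ℕ}
    (Fp : Fin (N + 1) → MvPolynomial (Fin (N + 1)) (𝓞 K))
    (α : Fin (N + 1) → 𝓞 K) (m : ℕ) : Ideal (𝓞 K) :=
  ∏ ij ∈ (Finset.range (m + 1) ×ˢ Finset.range (m + 1)).filter (fun ij => ij.1 < ij.2),
    auxMinor K ((FmapK K Fp)^[ij.1] α) ((FmapK K Fp)^[ij.2] α)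

theorem aux_orbit (K : Type) [Field K] [NumberField K] (N d : ℕ) (hd : 2 ≤ d)
    (Fp : Fin (N + 1) → MvPolynomial (Fin (N + 1)) (𝓞 K))
    (hhom : ∀ i, (Fp i).IsHomogeneous d) (α : Fin (N + 1) → 𝓞 K)
    (p : Ideal (𝓞 K)) (hg : GoodIdeal K Fp α p) (m : ℕ) :
    orbitLenK K Fp α p ≤ m ↔ p ∣ auxD K Fp α m := by
  obtain ⟨hp, hp0, hα, hmax, hz⟩ := hg
  have hfin : Finite (𝓞 K ⧸ p) := Ideal.finiteQuotientOfFreeOfNeBot p hp0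
  set v : ℕ → Fin (N + 1) → 𝓞 K ⧸ p :=
    fun n i => Ideal.Quotient.mk p (((FmapK K Fp)^[n] α) i) with hv
  have hsucc : ∀ n i, v (n + 1) i = eval (v n) ((Fp i).map (Ideal.Quotient.mk p)) := by
    intro n i
    simp only [hv, Function.iterate_succ_apply']
    rw [eval_map]
    exact (eval₂_comp _ _ _)
  have hne : ∀ n, v n ≠ 0 := by
    intro n
    induction n with
    | zero =>
      intro h0
      apply hα
      rw [Ideal.span_le]
      rintro _ ⟨i, rfl⟩
      exact Ideal.Quotient.eq_zero_iff_mem.1 (congrFun h0 i)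
    | succ n ih =>
      intro h0
      apply ih
      let _ : Field ((𝓞 K) ⧸ p) := @Ideal.Quotient.field _ _ p hmax
      have := hz (fun i => algebraMap _ _ (v n i)) (fun i => by
        have h1 := hsucc n i
        rw [h0] at h1
        have h2 := aeval_algebraMap_apply (AlgebraicClosure ((𝓞 K) ⧸ p)) (v n)
          ((Fp i).map (Ideal.Quotient.mk p))
        refine h2.trans ?_
        have h3 : aeval (v n) ((Fp i).map (Ideal.Quotient.mk p)) = 0 :=
          (RingHom.congr_fun (coe_aeval_eq_eval (v n)) _).trans h1.symm
        rw [h3, map_zero])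
      funext i
      have h3 := congrFun this i
      simpa using h3
  have hk : IsField (𝓞 K ⧸ p) := (Ideal.Quotient.maximal_ideal_iff_isField_quotient p).1 hmax
  have hrel : ∀ i j, Quotient.mk (MulAction.orbitRel ((𝓞 K) ⧸ p)ˣ (Fin (N + 1) → (𝓞 K) ⧸ p)) (v i) =
      Quotient.mk (MulAction.orbitRel ((𝓞 K) ⧸ p)ˣ (Fin (N + 1) → (𝓞 K) ⧸ p)) (v j) ↔
      ∃ u : ((𝓞 K) ⧸ p)ˣ, u • v j = v i := by
    intro i j
    rw [Quotient.eq]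
    exact Iff.rfl
  unfold orbitLenK
  rw [aux_count _ _ m]
  · rw [auxD, Prime.dvd_finsetProd_iff (Ideal.prime_of_isPrime hp0 hp)]
    have key : ∀ i j, (p ∣ auxMinor K ((FmapK K Fp)^[i] α) ((FmapK K Fp)^[j] α) ↔
        ∃ u : ((𝓞 K) ⧸ p)ˣ, u • v j = v i) := by
      intro i j
      rw [aux_minors hk _ _ (hne i) (hne j), Ideal.dvd_iff_le, auxMinor, Ideal.span_le]
      constructor
      · intro h a b
        have := h ⟨(a, b), rfl⟩
        rw [SetLike.mem_coe, ← Ideal.Quotient.eq_zero_iff_mem] at this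
        simpa [sub_eq_zero] using this
      · rintro h _ ⟨⟨a, b⟩, rfl⟩
        rw [SetLike.mem_coe, ← Ideal.Quotient.eq_zero_iff_mem]
        simpa [sub_eq_zero] using h a b
    constructor
    · rintro ⟨i, j, hij, hjm, h⟩
      refine ⟨(i, j), by simp; omega, (key i j).2 ((hrel i j).1 h)⟩
    · rintro ⟨⟨i, j⟩, h1, h⟩
      simp at h1
      exact ⟨i, j, h1.2, by omega, (hrel i j).2 ((key i j).1 h)⟩
  · intro i j h
    rw [hrel] at h ⊢
    obtain ⟨u, hu⟩ := h
    refine ⟨u ^ d, ?_⟩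
    funext a
    rw [hsucc, ← hu, Pi.smul_apply, hsucc]
    have := aux_eval_smul ((Fp a).map (Ideal.Quotient.mk p)) ((hhom a).map _) (u : 𝓞 K ⧸ p) (v j)
    rw [Units.smul_def, smul_eq_mul, Units.val_pow_eq_pow_val]
    exact this.symm

theorem aux_bound (K : Type) [Field K] [NumberField K] (N d : ℕ)
    (Fp : Fin (N + 1) → MvPolynomial (Fin (N + 1)) (𝓞 K))
    (hhom : ∀ i, (Fp i).IsHomogeneous d) (α : Fin (N + 1) → 𝓞 K)
    (horbit : ∀ m n : ℕ, m < n → ∃ i j : Fin (N + 1),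
      ((FmapK K Fp)^[m] α) i * ((FmapK K Fp)^[n] α) j ≠
        ((FmapK K Fp)^[m] α) j * ((FmapK K Fp)^[n] α) i) :
    ∃ C : ℝ, 0 < C ∧ ∀ m : ℕ, 1 ≤ m →
      (Ideal.absNorm (auxD K Fp α m) : ℝ) ≤ Real.exp (Real.exp (C * m)) := by
  obtain ⟨A, hA, hH⟩ := aux_house_iter K N d Fp hhom α
  set g := Module.finrank ℚ K with hg
  refine ⟨3 * A * g + (d + 1) + 2, by positivity, ?_⟩
  intro m hm
  have hA1 : 1 ≤ A := by linarith
  have hone : ∀ i j : ℕ, i < j → j ≤ m →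
      (Ideal.absNorm (auxMinor K ((FmapK K Fp)^[i] α) ((FmapK K Fp)^[j] α)) : ℝ) ≤
        (A ^ (3 * (d + 1) ^ m)) ^ g := by
    intro i j hij hjm
    obtain ⟨a, b, hab⟩ := horbit i j hij
    have hmem : ((FmapK K Fp)^[i] α) a * ((FmapK K Fp)^[j] α) b -
        ((FmapK K Fp)^[i] α) b * ((FmapK K Fp)^[j] α) a ∈
        auxMinor K ((FmapK K Fp)^[i] α) ((FmapK K Fp)^[j] α) :=
      Ideal.subset_span ⟨(a, b), rfl⟩
    refine (aux_norm K _ _ (sub_ne_zero.2 hab) hmem).trans ?_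
    refine pow_le_pow_left₀ (house_nonneg _) ?_ _
    have hle : ∀ n c, n ≤ m → house (((FmapK K Fp)^[n] α) c : K) ≤ A ^ ((d + 1) ^ m) := by
      intro n c hn
      exact (hH n c).trans (pow_le_pow_right₀ hA1 (Nat.pow_le_pow_right (by omega) hn))
    have hprod : ∀ c e, house ((((FmapK K Fp)^[i] α) c : K) * (((FmapK K Fp)^[j] α) e : K)) ≤
        A ^ ((d + 1) ^ m) * A ^ ((d + 1) ^ m) := fun c e =>
      (house_mul_le _ _).trans (mul_le_mul (hle i c (by omega)) (hle j e hjm) (house_nonneg _)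
        (by positivity))
    have hsub : ∀ x y : K, house (x - y) ≤ house x + house y := by
      intro x y
      simp only [house, map_sub]
      exact norm_sub_le _ _
    have h1 := hsub ((((FmapK K Fp)^[i] α) a : K) * (((FmapK K Fp)^[j] α) b : K))
      ((((FmapK K Fp)^[i] α) b : K) * (((FmapK K Fp)^[j] α) a : K))
    have h2 := hprod a b
    have h3 := hprod b a
    push_cast
    have h4 : A ≤ A ^ ((d + 1) ^ m) := le_self_pow₀ hA1 (by positivity)
    calc _ ≤ 2 * (A ^ ((d + 1) ^ m) * A ^ ((d + 1) ^ m)) := by linarith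
      _ ≤ A ^ ((d + 1) ^ m) * (A ^ ((d + 1) ^ m) * A ^ ((d + 1) ^ m)) := by
        gcongr
        linarith
      _ = _ := by ring
  have hB1 : 1 ≤ (A ^ (3 * (d + 1) ^ m)) ^ g := one_le_pow₀ (one_le_pow₀ hA1)
  have hD : (Ideal.absNorm (auxD K Fp α m) : ℝ) ≤
      ((A ^ (3 * (d + 1) ^ m)) ^ g) ^ ((m + 1) * (m + 1)) := by
    rw [auxD, map_prod, Nat.cast_prod]
    refine (Finset.prod_le_prod (fun _ _ => Nat.cast_nonneg _)
      (g := fun _ => (A ^ (3 * (d + 1) ^ m)) ^ g) ?_).trans ?_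
    · rintro ⟨i, j⟩ hij
      simp at hij
      exact hone i j hij.2 (by omega)
    · rw [Finset.prod_const]
      refine pow_le_pow_right₀ hB1 ((Finset.card_filter_le _ _).trans ?_)
      simp
  refine hD.trans ?_
  have hAe : A ≤ Real.exp A := by linarith [Real.add_one_le_exp A]
  rw [← pow_mul, ← pow_mul]
  refine (pow_le_pow_left₀ (by linarith) hAe _).trans ?_
  rw [← Real.exp_nat_mul, Real.exp_le_exp]
  have hm' : (1 : ℝ) ≤ m := by exact_mod_cast hm
  have e1 : 3 * A * g ≤ Real.exp (3 * A * g * m) := by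
    have h := Real.add_one_le_exp (3 * A * g * m)
    have : 3 * A * g * 1 ≤ 3 * A * g * m := by gcongr
    linarith
  have e2 : ((d : ℝ) + 1) ^ m ≤ Real.exp ((d + 1) * m) := by
    rw [mul_comm, Real.exp_nat_mul]
    refine pow_le_pow_left₀ (by positivity) ?_ _
    linarith [Real.add_one_le_exp ((d : ℝ) + 1)]
  have e3 := Real.add_one_le_exp (m : ℝ)
  have hexp : Real.exp ((3 * A * g + (d + 1) + 2) * m) =
      Real.exp (3 * A * g * m) * Real.exp ((d + 1) * m) * (Real.exp m * Real.exp m) := by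
    rw [← Real.exp_add, ← Real.exp_add, ← Real.exp_add]
    congr 1
    ring
  rw [hexp]
  push_cast
  calc _ = (3 * A * g) * ((d : ℝ) + 1) ^ m * (((m : ℝ) + 1) * (m + 1)) := by ring
    _ ≤ _ := by gcongr

theorem stmt10 (K : Type) [Field K] [NumberField K] (N d : ℕ) (hN : 1 ≤ N) (hd : 2 ≤ d)
    (Fp : Fin (N + 1) → MvPolynomial (Fin (N + 1)) (𝓞 K))
    (hhom : ∀ i, (Fp i).IsHomogeneous d)
    (hzero : ∀ x : Fin (N + 1) → AlgebraicClosure K,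
      (∀ i, MvPolynomial.aeval x ((Fp i).map (algebraMap (𝓞 K) K)) = 0) → x = 0)
    (α : Fin (N + 1) → 𝓞 K) (hα : α ≠ 0)
    (horbit : ∀ m n : ℕ, m < n → ∃ i j : Fin (N + 1),
      ((FmapK K Fp)^[m] α) i * ((FmapK K Fp)^[n] α) j ≠
        ((FmapK K Fp)^[m] α) j * ((FmapK K Fp)^[n] α) i) :
    ∃ C : ℝ, 0 < C ∧ ∃ S : Finset (Ideal (𝓞 K)),
      (∀ p : Ideal (𝓞 K), p.IsPrime → p ≠ ⊥ → ¬ GoodIdeal K Fp α p → p ∈ S) ∧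
      ∃ D : ℕ → Ideal (𝓞 K), ∀ m : ℕ, 1 ≤ m →
        D m ≠ ⊥ ∧
        (∀ p : Ideal (𝓞 K), p.IsPrime → p ≠ ⊥ → p ∉ S →
          (orbitLenK K Fp α p ≤ m ↔ p ∣ D m)) ∧
        (Ideal.absNorm (D m) : ℝ) ≤ Real.exp (Real.exp (C * m)) := by

  obtain ⟨S, hS⟩ := aux_S K N Fp hzero α hα
  obtain ⟨C, hC, hbound⟩ := aux_bound K N d Fp hhom α horbit
  refine ⟨C, hC, S, hS, auxD K Fp α, fun m hm => ⟨?_, ?_, hbound m hm⟩⟩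
  · rw [auxD, ← Ideal.zero_eq_bot, Finset.prod_ne_zero_iff]
    rintro ⟨i, j⟩ hij h0
    simp only [Finset.mem_filter] at hij
    obtain ⟨a, b, hab⟩ := horbit i j hij.2
    have h1 : ((FmapK K Fp)^[i] α) a * ((FmapK K Fp)^[j] α) b -
        ((FmapK K Fp)^[i] α) b * ((FmapK K Fp)^[j] α) a ∈
        auxMinor K ((FmapK K Fp)^[i] α) ((FmapK K Fp)^[j] α) :=
      Ideal.subset_span ⟨(a, b), rfl⟩
    rw [h0] at h1
    exact hab (sub_eq_zero.1 (by simpa using h1))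
  · intro p hp hp0 hpS
    refine aux_orbit K N d hd Fp hhom α p ?_ m
    by_contra hcon
    exact hpS (hS p hp hp0 hcon)
end
end

section
/- There exist a constant C > 0, a finite set S of rational primes containing all primes that are not good, and for each integer m ≥ 1 a nonzero integer D(m), such that: (i) for every rational prime p ∉ S, one has m_p(φ,P) ≤ m if and only if p divides D(m); and (ii) for every m ≥ 1, |D(m)| ≤ exp(exp(C·m)). -/
open MvPolynomial Filter Topology

noncomputable section

lemma aux_deg {n d : ℕ} {f : MvPolynomial (Fin n) ℤ} (hf : f.IsHomogeneous d)
    {e : Fin n →₀ ℕ} (he : e ∈ f.support) : ∑ i, e i = d := by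
  have h := hf (mem_support_iff.mp he)
  rw [← h, Finsupp.weight_apply, Finsupp.sum_fintype _ _ (by simp)]
  simp

lemma aux_smul {n d : ℕ} {f : MvPolynomial (Fin n) ℤ} (hf : f.IsHomogeneous d)
    {R : Type*} [CommRing R] (u : R) (x : Fin n → R) :
    aeval (fun i => u * x i) f = u ^ d * aeval x f := by
  rw [aeval_def, aeval_def, eval₂_eq', eval₂_eq', Finset.mul_sum]
  refine Finset.sum_congr rfl fun e he => ?_
  simp only [mul_pow, Finset.prod_mul_distrib]
  rw [Finset.prod_pow_eq_pow_sum, aux_deg hf he]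
  ring

lemma aux_bound_s12 {n d : ℕ} {f : MvPolynomial (Fin n) ℤ} (hf : f.IsHomogeneous d)
    (x : Fin n → ℤ) (H : ℤ) (hx : ∀ i, |x i| ≤ H) :
    |eval x f| ≤ (∑ e ∈ f.support, |f.coeff e|) * H ^ d := by
  rw [eval_eq', Finset.sum_mul]
  refine (Finset.abs_sum_le_sum_abs _ _).trans (Finset.sum_le_sum fun e he => ?_)
  rw [abs_mul, Finset.abs_prod, ← aux_deg hf he, ← Finset.prod_pow_eq_pow_sum]
  refine mul_le_mul_of_nonneg_left ?_ (abs_nonneg _)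
  refine Finset.prod_le_prod (fun _ _ => abs_nonneg _) fun i _ => ?_
  rw [abs_pow]
  exact pow_le_pow_left₀ (abs_nonneg _) (hx i) _

lemma aux_orbit_s12 {α : Type*} [Finite α] (T : α → α) (x : α) (m : ℕ) :
    (Set.range fun n : ℕ => T^[n] x).ncard ≤ m ↔ ∃ i j, i < j ∧ j ≤ m ∧ T^[i] x = T^[j] x := by
  constructor
  · intro h
    by_contra hne
    push Not at hne
    have hinj : Set.InjOn (fun n : ℕ => T^[n] x) (Finset.range (m + 1) : Set ℕ) := by
      intro i hi j hj hij
      simp only [Finset.coe_range, Set.mem_Iio] at hi hj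
      rcases lt_trichotomy i j with h1 | h1 | h1
      · exact absurd hij (hne i j h1 (by omega))
      · exact h1
      · exact absurd hij.symm (hne j i h1 (by omega))
    have h1 := Set.InjOn.ncard_image hinj
    rw [Set.ncard_coe_finset, Finset.card_range] at h1
    have h2 := Set.ncard_le_ncard (Set.image_subset_range (fun n : ℕ => T^[n] x)
      (Finset.range (m + 1) : Set ℕ)) (Set.toFinite _)
    omega
  · rintro ⟨i, j, hij, hjm, h⟩
    have hsub : (Set.range fun n : ℕ => T^[n] x) ⊆
        (fun n : ℕ => T^[n] x) '' (Finset.range j : Set ℕ) := by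
      rintro _ ⟨n, rfl⟩
      induction n using Nat.strong_induction_on with
      | _ n ih =>
        by_cases hn : n < j
        · exact ⟨n, by simpa using hn, rfl⟩
        · have h1 : T^[n] x = T^[n - j + i] x := by
            rw [Function.iterate_add_apply, h, ← Function.iterate_add_apply]
            congr 2
            omega
          have h2 := ih (n - j + i) (by omega)
          simpa only [h1] using h2
    have h1 := Set.ncard_le_ncard hsub (Set.toFinite _)
    have h2 := Set.ncard_image_le (s := (Finset.range j : Set ℕ)) (f := fun n : ℕ => T^[n] x)
    rw [Set.ncard_coe_finset, Finset.card_range] at h2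
    omega

lemma aux_prop {n : ℕ} {K : Type*} [Field K] (b c : Fin n → K) (hb : b ≠ 0) (hc : c ≠ 0) :
    Quotient.mk (MulAction.orbitRel Kˣ (Fin n → K)) b = Quotient.mk _ c ↔
      ∀ i j, b i * c j = b j * c i := by
  rw [Quotient.eq, MulAction.orbitRel_apply, MulAction.mem_orbit_iff]
  constructor
  · rintro ⟨u, rfl⟩ i j
    simp only [Pi.smul_apply, Units.smul_def, smul_eq_mul]
    ring
  · intro h
    obtain ⟨k, hk⟩ := Function.ne_iff.mp hc
    simp only [Pi.zero_apply] at hk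
    have hbk : b k ≠ 0 := by
      intro h0
      apply hb
      funext i
      have := h i k
      rw [h0, zero_mul] at this
      exact (mul_eq_zero.mp this).resolve_right hk
    refine ⟨Units.mk0 (b k / c k) (div_ne_zero hbk hk), ?_⟩
    funext i
    simp only [Pi.smul_apply, Units.smul_def, smul_eq_mul, Units.val_mk0]
    have := h i k
    field_simp
    linear_combination -this

section
attribute [local instance] MvPolynomial.algebraMvPolynomial

lemma aux_null {n : ℕ} (Fp : Fin n → MvPolynomial (Fin n) ℤ)
    (hzero : ∀ x : Fin n → AlgebraicClosure ℚ, (∀ i, aeval x (Fp i) = 0) → x = 0) (i : Fin n) :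
    ∃ c : ℤ, c ≠ 0 ∧ ∃ k : ℕ, C c * X i ^ k ∈ Ideal.span (Set.range Fp) := by
  set I := Ideal.span (Set.range Fp)
  set J := I.map (algebraMap (MvPolynomial (Fin n) ℤ) (MvPolynomial (Fin n) ℚ)) with hJ
  have h1 : (X i : MvPolynomial (Fin n) ℚ) ∈ vanishingIdeal ℚ (zeroLocus (AlgebraicClosure ℚ) J) := by
    intro x hx
    have : x = 0 := by
      apply hzero
      intro j
      have := hx _ (Ideal.mem_map_of_mem _ (Ideal.subset_span ⟨j, rfl⟩))
      rwa [MvPolynomial.algebraMap_def, aeval_map_algebraMap] at this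
    simp [this]
  rw [vanishingIdeal_zeroLocus_eq_radical] at h1
  obtain ⟨k, hk⟩ := h1
  have h2 : algebraMap (MvPolynomial (Fin n) ℤ) (MvPolynomial (Fin n) ℚ) (X i ^ k) ∈ J := by
    rw [map_pow, MvPolynomial.algebraMap_def, map_X]
    exact hk
  rw [hJ, IsLocalization.algebraMap_mem_map_algebraMap_iff
    ((nonZeroDivisors ℤ).map (C (σ := Fin n)))] at h2
  obtain ⟨_, ⟨c, hc, rfl⟩, h⟩ := h2
  exact ⟨c, nonZeroDivisors.ne_zero hc, k, h⟩

end

lemma aux_bad {N : ℕ} (Fp : Fin (N + 1) → MvPolynomial (Fin (N + 1)) ℤ)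
    (hzero : ∀ x : Fin (N + 1) → AlgebraicClosure ℚ, (∀ i, aeval x (Fp i) = 0) → x = 0) :
    ∃ S : Finset ℕ, ∀ p : ℕ, p.Prime → ¬ GoodPrime Fp p → p ∈ S := by
  choose c hc k hk using aux_null Fp hzero
  refine ⟨(∏ i, c i).natAbs.primeFactors, fun p hp hbad => ?_⟩
  have hne : ∏ i, c i ≠ 0 := Finset.prod_ne_zero_iff.mpr fun i _ => hc i
  rw [Nat.mem_primeFactors]
  refine ⟨hp, ?_, by simpa using hne⟩
  by_contra hndvd
  apply hbad
  have : Fact p.Prime := ⟨hp⟩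
  refine ⟨this, fun x hx => ?_⟩
  funext i
  have h1 : aeval x (C (c i) * X i ^ k i : MvPolynomial (Fin (N + 1)) ℤ) = 0 := by
    have : Ideal.span (Set.range Fp) ≤ RingHom.ker (aeval (R := ℤ) x) := by
      rw [Ideal.span_le]
      rintro _ ⟨j, rfl⟩
      exact hx j
    exact this (hk i)
  have h2 : ((c i : ℤ) : AlgebraicClosure (ZMod p)) ≠ 0 := by
    intro h
    rw [CharP.intCast_eq_zero_iff _ p] at h
    exact hndvd (Int.natCast_dvd.mp (h.trans (Finset.dvd_prod_of_mem c (Finset.mem_univ i))))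
  simp only [map_mul, map_pow, aeval_X, aeval_C] at h1
  have h3 := (mul_eq_zero.mp h1).resolve_left (by simpa using h2)
  exact eq_zero_of_pow_eq_zero h3

/-- Reduction of iterates modulo `p`. -/
def redG {N : ℕ} (Fp : Fin (N + 1) → MvPolynomial (Fin (N + 1)) ℤ) (p : ℕ)
    (b : Fin (N + 1) → ZMod p) : Fin (N + 1) → ZMod p := fun i => aeval b (Fp i)

lemma aux_red {N : ℕ} (Fp : Fin (N + 1) → MvPolynomial (Fin (N + 1)) ℤ) (p : ℕ)
    (b : Fin (N + 1) → ℤ) :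
    (fun i => ((Fmap Fp b i : ℤ) : ZMod p)) = redG Fp p (fun i => (b i : ZMod p)) := by
  funext i
  have := aeval_algebraMap_apply (ZMod p) b (Fp i)
  simp only [redG, Fmap]
  have h2 : (fun i => ((b i : ℤ) : ZMod p)) = (algebraMap ℤ (ZMod p)) ∘ b := by
    funext j; simp
  rw [h2]
  simpa [aeval_eq_eval] using this.symm

lemma aux_red_ne {N : ℕ} (Fp : Fin (N + 1) → MvPolynomial (Fin (N + 1)) ℤ) (p : ℕ)
    (hg : GoodPrime Fp p) (b : Fin (N + 1) → ZMod p) (hb : b ≠ 0) : redG Fp p b ≠ 0 := by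
  obtain ⟨hp, hg⟩ := hg
  intro h
  apply hb
  have h1 := hg (fun i => algebraMap (ZMod p) (AlgebraicClosure (ZMod p)) (b i)) (fun i => by
    have := aeval_algebraMap_apply (AlgebraicClosure (ZMod p)) b (Fp i)
    have h3 : aeval b (Fp i) = 0 := congrFun h i
    rw [h3, map_zero] at this
    exact this)
  funext i
  have := congrFun h1 i
  simpa using this

lemma aux_iter {N d : ℕ} (Fp : Fin (N + 1) → MvPolynomial (Fin (N + 1)) ℤ)
    (hhom : ∀ i, (Fp i).IsHomogeneous d) (a : Fin (N + 1) → ℤ) (p m : ℕ) (hp : p.Prime)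
    (hg : GoodPrime Fp p) (hcop : Finset.univ.gcd a = 1) :
    orbitLen Fp a p ≤ m ↔ ∃ i j, i < j ∧ j ≤ m ∧ ∀ k l : Fin (N + 1),
      (p : ℤ) ∣ ((Fmap Fp)^[i] a) k * ((Fmap Fp)^[j] a) l
        - ((Fmap Fp)^[i] a) l * ((Fmap Fp)^[j] a) k := by
  have : Fact p.Prime := ⟨hp⟩
  let r : (Fin (N + 1) → ℤ) → (Fin (N + 1) → ZMod p) := fun b i => (b i : ZMod p)
  have hr : ∀ n, r ((Fmap Fp)^[n] a) ≠ 0 := by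
    intro n
    induction n with
    | zero =>
      intro h
      have h1 : (p : ℤ) ∣ Finset.univ.gcd a := Finset.dvd_gcd fun i _ => by
        have := congrFun h i
        exact (ZMod.intCast_zmod_eq_zero_iff_dvd _ _).mp this
      rw [hcop] at h1
      have h2 := Int.natCast_dvd.mp h1
      exact hp.one_lt.ne' (by simpa using h2)
    | succ n ih =>
      rw [Function.iterate_succ_apply']
      have := aux_red Fp p ((Fmap Fp)^[n] a)
      change r _ = _ at this
      rw [this]
      exact aux_red_ne Fp p hg _ ih
  let s := MulAction.orbitRel (ZMod p)ˣ (Fin (N + 1) → ZMod p)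
  let T : Quotient s → Quotient s := Quotient.map (redG Fp p) (by
    intro b c hbc
    obtain ⟨u, rfl⟩ := hbc
    refine ⟨u ^ d, ?_⟩
    funext i
    exact (aux_smul (hhom i) (u : ZMod p) c).symm)
  have hT : ∀ n, T^[n] (Quotient.mk s (r a)) = Quotient.mk s (r ((Fmap Fp)^[n] a)) := by
    intro n
    induction n with
    | zero => rfl
    | succ n ih =>
      rw [Function.iterate_succ_apply', Function.iterate_succ_apply', ih]
      have := aux_red Fp p ((Fmap Fp)^[n] a)
      change r _ = _ at this
      rw [this]
      rfl
  have hset : orbitLen Fp a p = (Set.range fun n : ℕ => T^[n] (Quotient.mk s (r a))).ncard := by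
    unfold orbitLen
    congr 2
    funext n
    exact (hT n).symm
  rw [hset, aux_orbit_s12]
  refine exists_congr fun i => exists_congr fun j => and_congr_right fun _ =>
    and_congr_right fun _ => ?_
  rw [hT, hT, aux_prop _ _ (hr i) (hr j)]
  refine forall_congr' fun k => forall_congr' fun l => ?_
  rw [← ZMod.intCast_zmod_eq_zero_iff_dvd, Int.cast_sub, sub_eq_zero, Int.cast_mul, Int.cast_mul]

lemma aux_growth {N d : ℕ} (Fp : Fin (N + 1) → MvPolynomial (Fin (N + 1)) ℤ)
    (hhom : ∀ i, (Fp i).IsHomogeneous d) (a : Fin (N + 1) → ℤ) :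
    ∃ M : ℤ, 2 ≤ M ∧ ∀ n i, |((Fmap Fp)^[n] a) i| ≤ M ^ ((d + 1) ^ n) := by
  let K : ℤ := ∑ i, ∑ e ∈ (Fp i).support, |(Fp i).coeff e|
  let A : ℤ := ∑ i, |a i|
  have hK : ∀ i, ∑ e ∈ (Fp i).support, |(Fp i).coeff e| ≤ K := fun i =>
    Finset.single_le_sum (f := fun i => ∑ e ∈ (Fp i).support, |(Fp i).coeff e|)
      (fun _ _ => Finset.sum_nonneg fun _ _ => abs_nonneg _) (Finset.mem_univ i)
  have hA : ∀ i, |a i| ≤ A := fun i =>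
    Finset.single_le_sum (f := fun i => |a i|) (fun _ _ => abs_nonneg _) (Finset.mem_univ i)
  have hK0 : 0 ≤ K := Finset.sum_nonneg fun _ _ => Finset.sum_nonneg fun _ _ => abs_nonneg _
  have hA0 : 0 ≤ A := Finset.sum_nonneg fun _ _ => abs_nonneg _
  refine ⟨K + A + 2, by omega, fun n => ?_⟩
  have hM : (1 : ℤ) ≤ K + A + 2 := by omega
  induction n with
  | zero => intro i; have := hA i; simp; omega
  | succ n ih =>
    intro i
    rw [Function.iterate_succ_apply']
    refine (aux_bound_s12 (hhom i) _ _ ih).trans ?_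
    calc _ ≤ (K + A + 2) * ((K + A + 2) ^ (d + 1) ^ n) ^ d :=
          mul_le_mul_of_nonneg_right ((hK i).trans (by omega)) (by positivity)
      _ = (K + A + 2) ^ (1 + (d + 1) ^ n * d) := by rw [pow_add, pow_one, pow_mul]
      _ ≤ _ := by
        refine pow_le_pow_right₀ hM ?_
        have : 1 ≤ (d + 1) ^ n := Nat.one_le_pow _ _ (by omega)
        rw [pow_succ]
        nlinarith

lemma aux_final (M : ℤ) (hM : 2 ≤ M) (A : ℕ) (hA : 1 ≤ A) :
    ∃ C : ℝ, 0 < C ∧ ∀ m : ℕ, 1 ≤ m → ((M : ℝ) ^ (A ^ m)) ≤ Real.exp (Real.exp (C * m)) := by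
  have hM' : (2 : ℝ) ≤ M := by exact_mod_cast hM
  have hA' : (1 : ℝ) ≤ A := by exact_mod_cast hA
  have hMA : (1 : ℝ) < M * A := by nlinarith
  refine ⟨Real.log (M * A), Real.log_pos hMA, fun m hm => ?_⟩
  have h1 : Real.exp (Real.log (M * A) * m) = (M * A : ℝ) ^ m := by
    rw [mul_comm, Real.exp_nat_mul, Real.exp_log (by linarith)]
  have h2 : (M : ℝ) ^ (A ^ m) = Real.exp (Real.log M * A ^ m) := by
    rw [mul_comm]
    have := Real.exp_nat_mul (Real.log M) (A ^ m)
    push_cast at this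
    rw [this, Real.exp_log (by linarith)]
  rw [h1, h2, Real.exp_le_exp, mul_pow]
  refine mul_le_mul_of_nonneg_right ?_ (by positivity)
  calc Real.log M ≤ M := (Real.log_le_sub_one_of_pos (by linarith)).trans (by linarith)
    _ = (M : ℝ) ^ 1 := by simp
    _ ≤ _ := pow_le_pow_right₀ (by linarith) hm

theorem stmt12 (N d : ℕ) (hN : 1 ≤ N) (hd : 2 ≤ d)
    (Fp : Fin (N + 1) → MvPolynomial (Fin (N + 1)) ℤ)
    (hhom : ∀ i, (Fp i).IsHomogeneous d)
    (hzero : ∀ x : Fin (N + 1) → AlgebraicClosure ℚ,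
      (∀ i, MvPolynomial.aeval x (Fp i) = 0) → x = 0)
    (a : Fin (N + 1) → ℤ)
    (hcop : Finset.univ.gcd a = 1)
    (horbit : ∀ m n : ℕ, m < n → ∃ i j : Fin (N + 1),
      ((Fmap Fp)^[m] a) i * ((Fmap Fp)^[n] a) j ≠ ((Fmap Fp)^[m] a) j * ((Fmap Fp)^[n] a) i) :
    ∃ C : ℝ, 0 < C ∧ ∃ S : Finset ℕ,
      (∀ p : ℕ, p.Prime → ¬ GoodPrime Fp p → p ∈ S) ∧
      ∃ D : ℕ → ℤ, ∀ m : ℕ, 1 ≤ m →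
        D m ≠ 0 ∧
        (∀ p : ℕ, p.Prime → p ∉ S → (orbitLen Fp a p ≤ m ↔ (p : ℤ) ∣ D m)) ∧
        (|D m| : ℝ) ≤ Real.exp (Real.exp (C * m)) := by
  obtain ⟨S, hS⟩ := aux_bad Fp hzero
  obtain ⟨M, hM, hgrow⟩ := aux_growth Fp hhom a
  obtain ⟨C, hC, hCb⟩ := aux_final M hM (16 * (d + 1)) (by omega)
  let mn : ℕ → ℕ → Fin (N + 1) × Fin (N + 1) → ℤ := fun i j kl =>
    ((Fmap Fp)^[i] a) kl.1 * ((Fmap Fp)^[j] a) kl.2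
      - ((Fmap Fp)^[i] a) kl.2 * ((Fmap Fp)^[j] a) kl.1
  let g : ℕ → ℕ → ℤ := fun i j => Finset.univ.gcd (mn i j)
  let P : ℕ → Finset (ℕ × ℕ) := fun m =>
    (Finset.range (m + 1) ×ˢ Finset.range (m + 1)).filter fun q => q.1 < q.2
  have hmn : ∀ i j, i < j → ∃ kl, mn i j kl ≠ 0 := by
    intro i j hij
    obtain ⟨k, l, h⟩ := horbit i j hij
    exact ⟨(k, l), sub_ne_zero.mpr h⟩
  have hg0 : ∀ i j, i < j → g i j ≠ 0 := by
    intro i j hij h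
    obtain ⟨kl, hkl⟩ := hmn i j hij
    exact hkl (Finset.gcd_eq_zero_iff.mp h kl (Finset.mem_univ _))
  refine ⟨C, hC, S, hS, fun m => ∏ q ∈ P m, g q.1 q.2, fun m hm => ⟨?_, ?_, ?_⟩⟩
  · refine Finset.prod_ne_zero_iff.mpr fun q hq => hg0 _ _ (Finset.mem_filter.mp hq).2
  · intro p hp hpS
    have hgood : GoodPrime Fp p := by
      by_contra h
      exact hpS (hS p hp h)
    rw [aux_iter Fp hhom a p m hp hgood hcop,
      Prime.dvd_finsetProd_iff (Nat.prime_iff_prime_int.mp hp)]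
    constructor
    · rintro ⟨i, j, hij, hjm, h⟩
      refine ⟨(i, j), ?_, Finset.dvd_gcd fun kl _ => h kl.1 kl.2⟩
      simp only [P, Finset.mem_filter, Finset.mem_product, Finset.mem_range]
      omega
    · rintro ⟨⟨i, j⟩, hq, h⟩
      simp only [P, Finset.mem_filter, Finset.mem_product, Finset.mem_range] at hq
      exact ⟨i, j, hq.2, by omega, fun k l =>
        h.trans (Finset.gcd_dvd (f := mn i j) (Finset.mem_univ (k, l)))⟩
  · refine le_trans ?_ (hCb m hm)
    have hM1 : (1 : ℤ) ≤ M := by omega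
    have hq : ∀ q ∈ P m, |g q.1 q.2| ≤ M ^ (3 * (d + 1) ^ m) := by
      rintro ⟨i, j⟩ hq
      simp only [P, Finset.mem_filter, Finset.mem_product, Finset.mem_range] at hq
      obtain ⟨kl, hkl⟩ := hmn i j hq.2
      have h1 : |g i j| ≤ |mn i j kl| :=
        Int.le_of_dvd (abs_pos.mpr hkl)
          ((abs_dvd_abs _ _).mpr (Finset.gcd_dvd (f := mn i j) (Finset.mem_univ kl)))
      refine h1.trans ?_
      have hb : ∀ n ≤ m, ∀ k, |((Fmap Fp)^[n] a) k| ≤ M ^ ((d + 1) ^ m) := fun n hn k =>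
        (hgrow n k).trans (pow_le_pow_right₀ hM1 (Nat.pow_le_pow_right (by omega) hn))
      have hB : (0 : ℤ) ≤ M ^ ((d + 1) ^ m) := by positivity
      have hp : ∀ k l, |((Fmap Fp)^[i] a) k * ((Fmap Fp)^[j] a) l| ≤
          M ^ ((d + 1) ^ m) * M ^ ((d + 1) ^ m) := fun k l => by
        rw [abs_mul]
        exact mul_le_mul (hb i (by omega) k) (hb j (by omega) l) (abs_nonneg _) hB
      have h2 : (2 : ℤ) ≤ M ^ ((d + 1) ^ m) :=
        hM.trans (le_self_pow₀ hM1 (by positivity))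
      calc |mn i j kl| ≤ _ := abs_sub _ _
        _ ≤ M ^ ((d + 1) ^ m) * M ^ ((d + 1) ^ m) + M ^ ((d + 1) ^ m) * M ^ ((d + 1) ^ m) :=
          add_le_add (hp _ _) (hp _ _)
        _ ≤ M ^ ((d + 1) ^ m) * M ^ ((d + 1) ^ m) * M ^ ((d + 1) ^ m) := by nlinarith
        _ = _ := by rw [← pow_add, ← pow_add]; congr 1; ring
    have hcard : (P m).card ≤ (m + 1) * (m + 1) :=
      (Finset.card_filter_le _ _).trans (by simp)
    have key : |∏ q ∈ P m, g q.1 q.2| ≤ M ^ ((16 * (d + 1)) ^ m) := by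
      rw [Finset.abs_prod]
      refine (Finset.prod_le_prod (fun _ _ => abs_nonneg _) hq).trans ?_
      rw [Finset.prod_const, ← pow_mul]
      refine pow_le_pow_right₀ hM1 ?_
      have h2 : m + 1 ≤ 2 ^ m := Nat.lt_two_pow_self
      have h3 : 3 ≤ 4 ^ m := le_trans (by norm_num) (Nat.pow_le_pow_right (by norm_num) hm : 4 ^ 1 ≤ 4 ^ m)
      calc 3 * (d + 1) ^ m * (P m).card ≤ 4 ^ m * (d + 1) ^ m * (2 ^ m * 2 ^ m) :=
            Nat.mul_le_mul (Nat.mul_le_mul_right _ h3) (hcard.trans (Nat.mul_le_mul h2 h2))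
        _ = _ := by rw [← mul_pow, ← mul_pow, ← mul_pow]; congr 1; ring
    exact_mod_cast key
end
end

section
/- There are constants c₁ > 0 and c₂ > 0, depending only on K, such that for every nonzero integral ideal 𝔇 of 𝓞_K with N(𝔇) ≥ 3: Σ over nonzero prime ideals 𝔭 dividing 𝔇 of (log N𝔭)/N𝔭 ≤ c₁·log(log N(𝔇)) + c₂. -/
open NumberField

noncomputable section

open ArithmeticFunction in
lemma mertens_aux (N : ℕ) (hN : 1 ≤ N) :
    ∑ d ∈ Finset.Ioc 0 N, vonMangoldt d / (d : ℝ) ≤ Real.log N + (Real.log 4 + 4) := by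
  have hN0 : (0 : ℝ) < N := by exact_mod_cast hN
  have h1 : ∑ d ∈ Finset.Ioc 0 N, vonMangoldt d * ((N / d : ℕ) : ℝ) ≤ N * Real.log N := by
    calc ∑ d ∈ Finset.Ioc 0 N, vonMangoldt d * ((N / d : ℕ) : ℝ)
        = ∑ d ∈ Finset.Ioc 0 N, ∑ m ∈ Finset.Ioc 0 N, if d ∣ m then vonMangoldt d else 0 := by
          refine Finset.sum_congr rfl fun d _ => ?_
          rw [← Finset.sum_filter, Finset.sum_const, Nat.Ioc_filter_dvd_card_eq_div,
            nsmul_eq_mul, mul_comm]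
      _ = ∑ m ∈ Finset.Ioc 0 N, ∑ d ∈ Finset.Ioc 0 N, if d ∣ m then vonMangoldt d else 0 :=
          Finset.sum_comm
      _ = ∑ m ∈ Finset.Ioc 0 N, Real.log m := by
          refine Finset.sum_congr rfl fun m hm => ?_
          rw [← Finset.sum_filter, ← vonMangoldt_sum]
          refine Finset.sum_congr ?_ fun _ _ => rfl
          ext d
          simp only [Finset.mem_Ioc] at hm
          simp only [Finset.mem_filter, Finset.mem_Ioc, Nat.mem_divisors]
          constructor
          · rintro ⟨_, h⟩
            exact ⟨h, by omega⟩
          · rintro ⟨h, _⟩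
            have := Nat.le_of_dvd hm.1 h
            have := Nat.pos_of_dvd_of_pos h hm.1
            exact ⟨⟨by omega, by omega⟩, h⟩
      _ ≤ ∑ m ∈ Finset.Ioc 0 N, Real.log N := by
          refine Finset.sum_le_sum fun m hm => ?_
          simp only [Finset.mem_Ioc] at hm
          apply Real.log_le_log
          · exact_mod_cast hm.1
          · exact_mod_cast hm.2
      _ = N * Real.log N := by simp
  have h2 : ∑ d ∈ Finset.Ioc 0 N, vonMangoldt d ≤ (Real.log 4 + 4) * N := by
    have := Chebyshev.psi_le_const_mul_self (x := N) (by positivity)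
    simpa [Chebyshev.psi] using this
  have h3 : (∑ d ∈ Finset.Ioc 0 N, vonMangoldt d / (d : ℝ)) * N ≤
      ∑ d ∈ Finset.Ioc 0 N, vonMangoldt d * ((N / d : ℕ) : ℝ) +
        ∑ d ∈ Finset.Ioc 0 N, vonMangoldt d := by
    rw [Finset.sum_mul, ← Finset.sum_add_distrib]
    refine Finset.sum_le_sum fun d hd => ?_
    have hlt : (N : ℝ) / d ≤ ((N / d : ℕ) : ℝ) + 1 := by
      rw [← Nat.floor_div_eq_div (K := ℝ)]
      exact (Nat.lt_floor_add_one _).le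
    calc vonMangoldt d / (d : ℝ) * N = vonMangoldt d * (N / d) := by ring
      _ ≤ vonMangoldt d * (((N / d : ℕ) : ℝ) + 1) :=
          mul_le_mul_of_nonneg_left hlt vonMangoldt_nonneg
      _ = _ := by ring
  refine le_of_mul_le_mul_right (a := (N : ℝ)) ?_ hN0
  linarith

lemma sum_log_absNorm_le {K : Type} [Field K] [NumberField K] (D : Ideal (𝓞 K)) (hD : D ≠ ⊥)
    (S : Finset (Ideal (𝓞 K))) (hS : ∀ p ∈ S, p.IsPrime ∧ p ≠ ⊥ ∧ p ∣ D) :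
    ∑ p ∈ S, Real.log (Ideal.absNorm p) ≤ Real.log (Ideal.absNorm D) := by
  have h : ∏ p ∈ S, p ∣ D := Finset.prod_primes_dvd D
    (fun p hp => Ideal.prime_of_isPrime (hS p hp).2.1 (hS p hp).1) (fun p hp => (hS p hp).2.2)
  have h2 : ∏ p ∈ S, Ideal.absNorm p ∣ Ideal.absNorm D := by
    rw [← map_prod]
    exact map_dvd _ h
  have hne : ∀ p ∈ S, Ideal.absNorm p ≠ 0 := fun p hp => by
    rw [Ne, Ideal.absNorm_eq_zero_iff]; exact (hS p hp).2.1
  have hDne : Ideal.absNorm D ≠ 0 := by rwa [Ne, Ideal.absNorm_eq_zero_iff]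
  rw [← Real.log_prod (fun p hp => by exact_mod_cast hne p hp)]
  apply Real.log_le_log
  · exact_mod_cast Nat.pos_of_ne_zero (Finset.prod_ne_zero_iff.2 hne)
  · exact_mod_cast Nat.le_of_dvd (Nat.pos_of_ne_zero hDne) h2

theorem stmt13 (K : Type) [Field K] [NumberField K] :
    ∃ c₁ c₂ : ℝ, 0 < c₁ ∧ 0 < c₂ ∧
      ∀ D : Ideal (𝓞 K), D ≠ ⊥ → 3 ≤ Ideal.absNorm D →
        (∑' p : {p : Ideal (𝓞 K) // p.IsPrime ∧ p ≠ ⊥ ∧ p ∣ D},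
            Real.log (Ideal.absNorm p.1) / (Ideal.absNorm p.1 : ℝ))
          ≤ c₁ * Real.log (Real.log (Ideal.absNorm D)) + c₂ := by
  classical
  set n : ℕ := Module.finrank ℤ (𝓞 K) with hn
  have hnpos : 0 < n := Module.finrank_pos
  have hl4 : 0 < Real.log 4 := Real.log_pos (by norm_num)
  refine ⟨n, n * (Real.log 4 + 4) + 1, by exact_mod_cast hnpos, by positivity, ?_⟩
  intro D hD h3
  set L : ℝ := Real.log (Ideal.absNorm D) with hL
  have hL1 : 1 ≤ L := by
    have h3' : (3 : ℝ) ≤ Ideal.absNorm D := by exact_mod_cast h3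
    rw [hL, Real.le_log_iff_exp_le (by linarith)]
    linarith [Real.exp_one_lt_d9]
  set N : ℕ := ⌊L⌋₊ with hN
  have hN1 : 1 ≤ N := Nat.le_floor (by simpa using hL1)
  have hNL : (N : ℝ) ≤ L := Nat.floor_le (by linarith)
  have hfin : {p : Ideal (𝓞 K) | p.IsPrime ∧ p ≠ ⊥ ∧ p ∣ D}.Finite := by
    refine (UniqueFactorizationMonoid.normalizedFactors D).toFinset.finite_toSet.subset ?_
    rintro p ⟨h1, h2, h3⟩
    simp only [Finset.mem_coe, Multiset.mem_toFinset]
    rw [Ideal.mem_normalizedFactors_iff hD]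
    exact ⟨h1, Ideal.le_of_dvd h3⟩
  set T := hfin.toFinset with hTdef
  have hT : ∀ p ∈ T, p.IsPrime ∧ p ≠ ⊥ ∧ p ∣ D := fun p hp => by simpa [hTdef] using hp
  set f : Ideal (𝓞 K) → ℝ := fun p => Real.log (Ideal.absNorm p) / (Ideal.absNorm p : ℝ) with hf
  have hsum : (∑' p : {p : Ideal (𝓞 K) // p.IsPrime ∧ p ≠ ⊥ ∧ p ∣ D}, f p.1) = ∑ p ∈ T, f p := by
    rw [← Finset.tsum_subtype T f]
    refine (Equiv.subtypeEquivRight fun p => ?_).tsum_eq (fun p : {p // p ∈ T} => f p.1)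
    simp [hTdef]
  change (∑' p : {p : Ideal (𝓞 K) // p.IsPrime ∧ p ≠ ⊥ ∧ p ∣ D}, f p.1) ≤ _
  rw [hsum, ← Finset.sum_filter_add_sum_filter_not T (fun p => Ideal.absNorm p ≤ N)]
  -- large primes
  have hbig : ∑ p ∈ T with ¬ Ideal.absNorm p ≤ N, f p ≤ 1 := by
    calc ∑ p ∈ T with ¬ Ideal.absNorm p ≤ N, f p
        ≤ ∑ p ∈ T with ¬ Ideal.absNorm p ≤ N, Real.log (Ideal.absNorm p) / L := by
          refine Finset.sum_le_sum fun p hp => ?_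
          rw [Finset.mem_filter, not_le, hN, Nat.floor_lt (by linarith)] at hp
          exact div_le_div_of_nonneg_left (Real.log_natCast_nonneg _) (by linarith) hp.2.le
      _ = (∑ p ∈ T with ¬ Ideal.absNorm p ≤ N, Real.log (Ideal.absNorm p)) / L := by
          rw [Finset.sum_div]
      _ ≤ L / L := by
          gcongr
          exact sum_log_absNorm_le D hD _ fun p hp => hT p (Finset.mem_filter.1 hp).1
      _ = 1 := div_self (by linarith)
  -- small primes
  set l : Ideal (𝓞 K) → ℕ := fun p => Ideal.absNorm (Ideal.under ℤ p) with hl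
  have hlprime : ∀ p ∈ T, (l p).Prime := fun p hp => by
    haveI := (hT p hp).1
    haveI : NeZero p := ⟨(hT p hp).2.1⟩
    exact Nat.absNorm_under_prime p
  have hlle : ∀ p ∈ T, l p ≤ Ideal.absNorm p := fun p hp =>
    Nat.le_of_dvd (Nat.pos_of_ne_zero (by
      rw [Ne, Ideal.absNorm_eq_zero_iff]; exact (hT p hp).2.1)) (Int.absNorm_under_dvd_absNorm p)
  have hsmall : ∑ p ∈ T with Ideal.absNorm p ≤ N, f p ≤ n * (Real.log N + (Real.log 4 + 4)) := by
    have hmaps : ∀ p ∈ T.filter (fun p => Ideal.absNorm p ≤ N), l p ∈ Finset.Ioc 0 N := by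
      intro p hp
      rw [Finset.mem_filter] at hp
      exact Finset.mem_Ioc.2 ⟨(hlprime p hp.1).pos, (hlle p hp.1).trans hp.2⟩
    rw [← Finset.sum_fiberwise_of_maps_to hmaps]
    refine le_trans ?_ (mul_le_mul_of_nonneg_left (mertens_aux N hN1) (Nat.cast_nonneg n))
    rw [Finset.mul_sum]
    refine Finset.sum_le_sum fun q hq => ?_
    by_cases hqp : q.Prime
    · rw [ArithmeticFunction.vonMangoldt_apply_prime hqp]
      have hq0 : (0 : ℝ) < q := by exact_mod_cast hqp.pos
      have hspan : Ideal.span {(q : 𝓞 K)} ≠ ⊥ := by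
        rw [Ne, Ideal.span_singleton_eq_bot]
        exact_mod_cast hqp.ne_zero
      calc _ ≤ ∑ p ∈ (T.filter (fun p => Ideal.absNorm p ≤ N)).filter (fun p => l p = q),
            Real.log (Ideal.absNorm p) / q := by
            refine Finset.sum_le_sum fun p hp => ?_
            simp only [Finset.mem_filter] at hp
            refine div_le_div_of_nonneg_left (Real.log_natCast_nonneg _) hq0 ?_
            have := hlle p hp.1.1
            rw [hp.2] at this
            exact_mod_cast this
        _ = (∑ p ∈ (T.filter (fun p => Ideal.absNorm p ≤ N)).filter (fun p => l p = q),
            Real.log (Ideal.absNorm p)) / q := by rw [Finset.sum_div]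
        _ ≤ Real.log (Ideal.absNorm (Ideal.span {(q : 𝓞 K)})) / q := by
            gcongr
            refine sum_log_absNorm_le _ hspan _ fun p hp => ?_
            simp only [Finset.mem_filter] at hp
            refine ⟨(hT p hp.1.1).1, (hT p hp.1.1).2.1, ?_⟩
            rw [Ideal.dvd_span_singleton, ← hp.2]
            exact Int.absNorm_under_mem p
        _ = n * (Real.log q / q) := by
            rw [Ideal.absNorm_span_natCast]
            push_cast
            rw [Real.log_pow]
            ring
    · rw [Finset.filter_false_of_mem, Finset.sum_empty]
      · have := @ArithmeticFunction.vonMangoldt_nonneg q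
        positivity
      · intro p hp h
        exact hqp (h ▸ hlprime p (Finset.mem_filter.1 hp).1)
  have hlog : Real.log N ≤ Real.log L := Real.log_le_log (by exact_mod_cast hN1) hNL
  have : (n : ℝ) * Real.log N ≤ n * Real.log L := by gcongr
  linarith
end
end
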